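/- (Theorem 3.4 / Theorem B.1: existence and uniqueness for the equilibrium system on a short time horizon.) Let the model data satisfy the Lipschitz assumptions and suppose that T satisfies L_Q̂ · T · ( Σ_{i=0}^{n} ( exp((Qmax + L_Q̂)·T) )^{i+1} · Jmax^i ) · (L_Ψ + K1·T) · exp(K2·T) · ( Σ_{i=0}^{n} ( exp(K2·T) · λmax · T )^i ) < 1. Then there exists a unique pair (μ, v) of regular functions, μ : TS → 𝒫(𝕊) and v : TS → ℝ^S, solving the equilibrium system (E1)–(E5). -/

import Mathlib

open MeasureTheory
open scoped BigOperators Classical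

namespace MFGShocks

/-- The probability simplex `𝒫(𝕊)` in `ℝ^S`. -/
def simplex (S : ℕ) : Set (Fin S → ℝ) :=
  {m | (∀ i, 0 ≤ m i) ∧ ∑ i, m i = 1}

/-- Membership in the parameter set `𝕌`: for some `k ≤ n`, the first `k` coordinates are
increasing and lie in `[0,T]` and the remaining coordinates equal `-1`. -/
def memU (n : ℕ) (T : ℝ) (u : Fin n → ℝ) : Prop :=
  ∃ k ≤ n, (∀ i : Fin n, (i : ℕ) < k → u i ∈ Set.Icc (0 : ℝ) T) ∧
    (∀ i j : Fin n, (j : ℕ) < k → i ≤ j → u i ≤ u j) ∧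
    (∀ i : Fin n, k ≤ (i : ℕ) → u i = -1)

/-- `Z(u)`: the number of coordinates of `u` different from `-1`, i.e.\ the number of
shocks recorded in `u`. -/
noncomputable def Zu {n : ℕ} (u : Fin n → ℝ) : ℕ :=
  (Finset.univ.filter fun i => u i ≠ -1).card

/-- Membership `(t,u) ∈ TS`. -/
def memTS (n : ℕ) (T : ℝ) (t : ℝ) (u : Fin n → ℝ) : Prop :=
  memU n T u ∧ t ∈ Set.Icc (0 : ℝ) T ∧ ∀ i, u i ≤ t

/-- `→(u,t)`: record a new shock at time `t` (replace coordinate `Z(u)+1` of `u` by `t`). -/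
noncomputable def push {n : ℕ} (u : Fin n → ℝ) (t : ℝ) : Fin n → ℝ :=
  fun i => if (i : ℕ) = Zu u then t else u i

/-- `←u`: delete the last shock (replace coordinate `Z(u)` of `u` by `-1`). -/
noncomputable def pop {n : ℕ} (u : Fin n → ℝ) : Fin n → ℝ :=
  fun i => if (i : ℕ) + 1 = Zu u then -1 else u i

/-- `t_u = u^{Z(u)}`: the time of the last shock recorded in `u` (`0` if there is none). -/
noncomputable def lastTime {n : ℕ} (u : Fin n → ℝ) : ℝ :=
  if h : Zu u - 1 < n then u ⟨Zu u - 1, h⟩ else 0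

/-- The left endpoint of the time interval associated with the parameter `u`:
`t_u` if `u` records at least one shock, and `0` otherwise. -/
noncomputable def startTime {n : ℕ} (u : Fin n → ℝ) : ℝ :=
  if Zu u = 0 then 0 else lastTime u

/-- `f` is absolutely continuous on the interval `[a,b]`. -/
def AbsContOn {E : Type*} [NormedAddCommGroup E] (f : ℝ → E) (a b : ℝ) : Prop :=
  ∀ ε > (0 : ℝ), ∃ δ > (0 : ℝ), ∀ (N : ℕ) (c d : Fin N → ℝ),
    (∀ k, a ≤ c k ∧ c k ≤ d k ∧ d k ≤ b) →
    (∀ k l, k ≠ l → Set.Ioo (c k) (d k) ∩ Set.Ioo (c l) (d l) = ∅) →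
    ∑ k, (d k - c k) < δ → ∑ k, ‖f (d k) - f (c k)‖ < ε

/-- A function `f : TS → ℝ^S` is regular if `f(·,u)` is absolutely continuous on
`[max_k u^k, T]` (intersected with `[0,T]`) for every `u ∈ 𝕌`. -/
def Regular (S n : ℕ) (T : ℝ) (f : ℝ → (Fin n → ℝ) → Fin S → ℝ) : Prop :=
  ∀ u : Fin n → ℝ, memU n T u → AbsContOn (fun t => f t u) (startTime u) T

/-- The model data: reduced-form running reward `ψ̂`, reduced-form intensity matrix `Q̂`,
shock intensities `λ`, terminal reward `Ψ`, relocation map `J` (independent of the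
distribution) and initial distribution `m₀`. -/
structure Model (S n : ℕ) where
  psi : ℝ → (Fin n → ℝ) → (Fin S → ℝ) → (Fin S → ℝ) → Fin S → ℝ
  Q : ℝ → (Fin n → ℝ) → (Fin S → ℝ) → (Fin S → ℝ) → Fin S → Fin S → ℝ
  lam : ℕ → ℝ → (Fin S → ℝ) → ℝ
  Psi : ℕ → (Fin S → ℝ) → Fin S → ℝ
  J : ℝ → Fin S → Fin S
  m0 : Fin S → ℝ

/-- The standing (boundedness, measurability, intensity-matrix and Lipschitz) assumptions on
the model data, together with the constants `Ψmax, ψmax, Qmax, λmax, Jmax` bounding the data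
and the Lipschitz constants `L_ψ̂, L_Q̂, L_Ψ, L_λ`.  Throughout, `ℝ^S` carries the maximum
norm and the matrix norm is the compatible induced one (maximal absolute row sum). -/
structure Hyps (S n : ℕ) (T : ℝ) (D : Model S n)
    (Lpsi LQ LPsi Llam Psimax psimax Qmax lammax : ℝ) (Jmax : ℕ) : Prop where
  hS : 1 ≤ S
  hn : 1 ≤ n
  hT : 0 < T
  hm0 : D.m0 ∈ simplex S
  hLpsi : 0 < Lpsi
  hLQ : 0 < LQ
  hLPsi : 0 < LPsi
  hLlam : 0 < Llam
  psi_meas : Measurable fun p : ℝ × (Fin n → ℝ) × (Fin S → ℝ) × (Fin S → ℝ) =>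
    D.psi p.1 p.2.1 p.2.2.1 p.2.2.2
  Q_meas : Measurable fun p : ℝ × (Fin n → ℝ) × (Fin S → ℝ) × (Fin S → ℝ) =>
    D.Q p.1 p.2.1 p.2.2.1 p.2.2.2
  lam_meas : ∀ k, Measurable fun p : ℝ × (Fin S → ℝ) => D.lam k p.1 p.2
  Psi_meas : ∀ k, Measurable (D.Psi k)
  J_meas : Measurable D.J
  psi_bdd : ∀ t u m v, memTS n T t u → m ∈ simplex S → ∀ i, |D.psi t u m v i| ≤ psimax
  Q_bdd : ∀ t u m v, memTS n T t u → m ∈ simplex S → ∀ i, ∑ j, |D.Q t u m v i j| ≤ Qmax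
  Q_offdiag : ∀ t u m v i j, i ≠ j → 0 ≤ D.Q t u m v i j
  Q_rowsum : ∀ t u m v i, ∑ j, D.Q t u m v i j = 0
  lam_pos : ∀ k, 1 ≤ k → k ≤ n → ∀ t ∈ Set.Icc (0 : ℝ) T, ∀ m ∈ simplex S,
    0 < D.lam k t m
  lam_bdd : ∀ k, 1 ≤ k → k ≤ n → ∀ t ∈ Set.Icc (0 : ℝ) T, ∀ m ∈ simplex S,
    D.lam k t m ≤ lammax
  Psi_bdd : ∀ k ≤ n, ∀ m ∈ simplex S, ∀ i, |D.Psi k m i| ≤ Psimax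
  psi_lip : ∀ t u, memTS n T t u → ∀ m₁ ∈ simplex S, ∀ m₂ ∈ simplex S,
    ∀ v₁ v₂ : Fin S → ℝ, ∀ i,
      |D.psi t u m₁ v₁ i - D.psi t u m₂ v₂ i| ≤ Lpsi * (‖m₁ - m₂‖ + ‖v₁ - v₂‖)
  Q_lip : ∀ t u, memTS n T t u → ∀ m₁ ∈ simplex S, ∀ m₂ ∈ simplex S,
    ∀ v₁ v₂ : Fin S → ℝ, ∀ i,
      ∑ j, |D.Q t u m₁ v₁ i j - D.Q t u m₂ v₂ i j| ≤ LQ * (‖m₁ - m₂‖ + ‖v₁ - v₂‖)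
  Psi_lip : ∀ k ≤ n, ∀ m₁ ∈ simplex S, ∀ m₂ ∈ simplex S,
    ‖D.Psi k m₁ - D.Psi k m₂‖ ≤ LPsi * ‖m₁ - m₂‖
  lam_lip : ∀ k, 1 ≤ k → k ≤ n → ∀ t ∈ Set.Icc (0 : ℝ) T, ∀ m₁ ∈ simplex S, ∀ m₂ ∈ simplex S,
    |D.lam k t m₁ - D.lam k t m₂| ≤ Llam * ‖m₁ - m₂‖
  J_bdd : ∀ t ∈ Set.Icc (0 : ℝ) T, ∀ j : Fin S,
    (Finset.univ.filter fun i => D.J t i = j).card ≤ Jmax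

/-- The constant `v_max`. -/
noncomputable def vmaxC (n : ℕ) (T Psimax psimax Qmax lammax : ℝ) : ℝ :=
  (Psimax + psimax * T) * Real.exp ((Qmax + lammax) * T) *
    ∑ i ∈ Finset.range (n + 1), (Real.exp ((Qmax + lammax) * T) * lammax * T) ^ i

/-- The constant `K₁ = L_ψ̂ + L_Q̂ v_max + 2 v_max L_λ`. -/
noncomputable def K1C (n : ℕ) (T Lpsi LQ Llam Psimax psimax Qmax lammax : ℝ) : ℝ :=
  Lpsi + LQ * vmaxC n T Psimax psimax Qmax lammax +
    2 * vmaxC n T Psimax psimax Qmax lammax * Llam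

/-- The constant `K₂ = L_ψ̂ + v_max L_Q̂ + Qmax + λmax`. -/
noncomputable def K2C (n : ℕ) (T Lpsi LQ Psimax psimax Qmax lammax : ℝ) : ℝ :=
  Lpsi + vmaxC n T Psimax psimax Qmax lammax * LQ + Qmax + lammax

/-- The right-hand side of the backward equation (E1), written for the integral
(Carathéodory) formulation `v(t,u) = Ψ(Z(u),μ(T,u)) + ∫_t^T (E1rhs)(s) ds`. -/
noncomputable def E1rhs {S n : ℕ} (D : Model S n)
    (μ v : ℝ → (Fin n → ℝ) → Fin S → ℝ) (u : Fin n → ℝ) (i : Fin S) (s : ℝ) : ℝ :=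
  D.psi s u (μ s u) (v s u) i + (∑ j, D.Q s u (μ s u) (v s u) i j * v s u j) +
    (if Zu u < n then
      D.lam (Zu u + 1) s (μ s u) * (v s (push u s) (D.J s i) - v s u i)
    else 0)

/-- `v` is a (Carathéodory) solution of the backward equation (E1) with terminal
condition (E3), given the flow `μ`. -/
def SolBackward (S n : ℕ) (T : ℝ) (D : Model S n)
    (μ v : ℝ → (Fin n → ℝ) → Fin S → ℝ) : Prop :=
  ∀ u : Fin n → ℝ, memU n T u →
    (∀ i : Fin S, v T u i = D.Psi (Zu u) (μ T u) i) ∧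
    ∀ t : ℝ, memTS n T t u → ∀ i : Fin S,
      IntervalIntegrable (E1rhs D μ v u i) volume t T ∧
      v t u i = D.Psi (Zu u) (μ T u) i + ∫ s in t..T, E1rhs D μ v u i s

/-- The right-hand side of the forward equation (E2). -/
noncomputable def E2rhs {S n : ℕ} (D : Model S n)
    (v μ : ℝ → (Fin n → ℝ) → Fin S → ℝ) (u : Fin n → ℝ) (i : Fin S) (s : ℝ) : ℝ :=
  ∑ j, μ s u j * D.Q s u (μ s u) (v s u) j i

/-- `μ` is a (Carathéodory) solution of the forward equation (E2) with initial
condition (E4) and consistency conditions (E5), given the value function `v`. -/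
def SolForward (S n : ℕ) (T : ℝ) (D : Model S n)
    (v μ : ℝ → (Fin n → ℝ) → Fin S → ℝ) : Prop :=
  (∀ i, μ 0 (fun _ => (-1 : ℝ)) i = D.m0 i) ∧
  (∀ u : Fin n → ℝ, memU n T u → 1 ≤ Zu u → ∀ j : Fin S,
    μ (lastTime u) u j =
      ∑ i, if D.J (lastTime u) i = j then μ (lastTime u) (pop u) i else 0) ∧
  (∀ u : Fin n → ℝ, memU n T u → ∀ t : ℝ, memTS n T t u → ∀ i : Fin S,
    IntervalIntegrable (E2rhs D v μ u i) volume (startTime u) t ∧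
    μ t u i = μ (startTime u) u i + ∫ s in (startTime u)..t, E2rhs D v μ u i s)

/-- Membership in `M`: a `𝒫(𝕊)`-valued function on `TS` that is `Qmax`-Lipschitz in time. -/
def MemM (S n : ℕ) (T Qmax : ℝ) (μ : ℝ → (Fin n → ℝ) → Fin S → ℝ) : Prop :=
  (∀ t u, memTS n T t u → μ t u ∈ simplex S) ∧
  ∀ u : Fin n → ℝ, memU n T u → ∀ t₁ t₂ : ℝ, memTS n T t₁ u → memTS n T t₂ u →
    ‖μ t₁ u - μ t₂ u‖ ≤ Qmax * |t₁ - t₂|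

/-- Membership in `V`: a regular function on `TS` bounded by `v_max` in supremum norm. -/
def MemV (S n : ℕ) (T vmaxVal : ℝ) (v : ℝ → (Fin n → ℝ) → Fin S → ℝ) : Prop :=
  Regular S n T v ∧ ∀ t u, memTS n T t u → ‖v t u‖ ≤ vmaxVal

/-- The supremum norm over `TS` of a function `f : TS → ℝ^S`. -/
noncomputable def supTS (S n : ℕ) (T : ℝ) (f : ℝ → (Fin n → ℝ) → Fin S → ℝ) : ℝ :=
  sSup {r : ℝ | ∃ t u, memTS n T t u ∧ r = ‖f t u‖}

end MFGShocks

namespace MFGShocks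

/-- The growth profile `e^{at} (b₀ + b t)`, an explicit supersolution of
`f(t) = b₀ + ∫₀ᵗ (a f + b)`. -/
noncomputable def expWeight (a b₀ b t : ℝ) : ℝ := Real.exp (a * t) * (b₀ + b * t)

/-- The geometric bound `e^{aT} b Σ_{i<j} (e^{aT} λ T)^i`. -/
noncomputable def geomBound (a b lam T : ℝ) (j : ℕ) : ℝ :=
  Real.exp (a * T) * b * ∑ i ∈ Finset.range j, (Real.exp (a * T) * lam * T) ^ i

/-- The weight for value functions after `k` of at most `n` shocks. -/
noncomputable def bwdWeight (a b₀ b₁ lam T : ℝ) (n k : ℕ) (t : ℝ) : ℝ :=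
  expWeight a b₀ (b₁ + lam * geomBound a (b₀ + b₁ * T) lam T (n - k)) (T - t)

lemma continuous_expWeight (a b₀ b : ℝ) : Continuous (expWeight a b₀ b) := by
  unfold expWeight; fun_prop

lemma continuous_bwdWeight (a b₀ b₁ lam T : ℝ) (n k : ℕ) :
    Continuous (bwdWeight a b₀ b₁ lam T n k) :=
  (continuous_expWeight _ _ _).comp (continuous_const.sub continuous_id)

lemma expWeight_zero (a b₀ b : ℝ) : expWeight a b₀ b 0 = b₀ := by simp [expWeight]

lemma expWeight_mono {a b₀ b s t : ℝ} (ha : 0 ≤ a) (hb₀ : 0 ≤ b₀) (hb : 0 ≤ b)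
    (hs : 0 ≤ s) (hst : s ≤ t) : expWeight a b₀ b s ≤ expWeight a b₀ b t := by
  unfold expWeight
  gcongr

lemma le_expWeight {a b₀ b t : ℝ} (ha : 0 ≤ a) (hb₀ : 0 ≤ b₀) (hb : 0 ≤ b) (ht : 0 ≤ t) :
    b₀ ≤ expWeight a b₀ b t := by
  simpa [expWeight_zero] using expWeight_mono ha hb₀ hb le_rfl ht

lemma expWeight_add_integral_le {a b₀ b s t : ℝ} (ha : 0 ≤ a) (hb : 0 ≤ b)
    (hs : 0 ≤ s) (hst : s ≤ t) :
    expWeight a b₀ b s + ∫ r in s..t, (a * expWeight a b₀ b r + b) ≤ expWeight a b₀ b t := by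
  have hd : ∀ r ∈ Set.uIcc s t, HasDerivAt (expWeight a b₀ b)
      (a * expWeight a b₀ b r + Real.exp (a * r) * b) r := by
    intro r _
    have h1 : HasDerivAt (fun r : ℝ => Real.exp (a * r)) (Real.exp (a * r) * a) r := by
      simpa using ((hasDerivAt_id r).const_mul a).exp
    have h2 : HasDerivAt (fun r : ℝ => b₀ + b * r) b r := by
      simpa using ((hasDerivAt_id r).const_mul b).const_add b₀
    refine HasDerivAt.congr_deriv (f := expWeight a b₀ b) (h1.mul h2) ?_
    simp only [expWeight]; ring
  have hc : Continuous fun r => a * expWeight a b₀ b r + Real.exp (a * r) * b := by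
    have := continuous_expWeight a b₀ b
    fun_prop
  have hftc := intervalIntegral.integral_eq_sub_of_hasDerivAt hd (hc.intervalIntegrable s t)
  have hmono : ∫ r in s..t, (a * expWeight a b₀ b r + b) ≤
      ∫ r in s..t, (a * expWeight a b₀ b r + Real.exp (a * r) * b) := by
    refine intervalIntegral.integral_mono_on hst ?_ (hc.intervalIntegrable s t) ?_
    · have := continuous_expWeight a b₀ b
      exact Continuous.intervalIntegrable (by fun_prop) _ _
    · intro r hr
      have : 1 ≤ Real.exp (a * r) := Real.one_le_exp (mul_nonneg ha (hs.trans hr.1))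
      nlinarith
  linarith

lemma expWeight_backward {a b₀ b t T : ℝ} (ha : 0 ≤ a) (hb : 0 ≤ b) (htT : t ≤ T) :
    b₀ + ∫ r in t..T, (a * expWeight a b₀ b (T - r) + b) ≤ expWeight a b₀ b (T - t) := by
  have h := expWeight_add_integral_le (b₀ := b₀) ha hb le_rfl (sub_nonneg.2 htT)
  rw [expWeight_zero] at h
  rwa [intervalIntegral.integral_comp_sub_left (fun r => a * expWeight a b₀ b r + b) T, sub_self]

lemma geomBound_nonneg {a b lam T : ℝ} (hb : 0 ≤ b) (hlam : 0 ≤ lam) (hT : 0 ≤ T) (j : ℕ) :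
    0 ≤ geomBound a b lam T j := by
  unfold geomBound; positivity

lemma geomBound_mono {a b lam T : ℝ} (hb : 0 ≤ b) (hlam : 0 ≤ lam) (hT : 0 ≤ T) {i j : ℕ}
    (hij : i ≤ j) : geomBound a b lam T i ≤ geomBound a b lam T j := by
  unfold geomBound
  refine mul_le_mul_of_nonneg_left ?_ (by positivity)
  exact Finset.sum_le_sum_of_subset_of_nonneg (Finset.range_mono hij) fun _ _ _ => by positivity

lemma expWeight_geomBound (a b₀ b₁ lam T : ℝ) (j : ℕ) :
    expWeight a b₀ (b₁ + lam * geomBound a (b₀ + b₁ * T) lam T j) T =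
      geomBound a (b₀ + b₁ * T) lam T (j + 1) := by
  rw [geomBound.eq_def _ _ _ _ (j + 1), geom_sum_succ, geomBound, expWeight]
  ring

section BwdWeight

variable {a b₀ b₁ lam T t : ℝ} {n k : ℕ}

lemma bwdWeight_le_geomBound_sub (ha : 0 ≤ a) (hb₀ : 0 ≤ b₀) (hb₁ : 0 ≤ b₁) (hlam : 0 ≤ lam)
    (ht : 0 ≤ t) (htT : t ≤ T) (hk : k ≤ n) :
    bwdWeight a b₀ b₁ lam T n k t ≤ geomBound a (b₀ + b₁ * T) lam T (n + 1 - k) := by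
  have hT : 0 ≤ T := ht.trans htT
  have hG := geomBound_nonneg (a := a) (b := b₀ + b₁ * T) (by positivity) hlam hT (n - k)
  rw [show n + 1 - k = n - k + 1 by omega, ← expWeight_geomBound]
  exact expWeight_mono ha hb₀ (by positivity) (by linarith) (by linarith)

lemma bwdWeight_le_geomBound (ha : 0 ≤ a) (hb₀ : 0 ≤ b₀) (hb₁ : 0 ≤ b₁) (hlam : 0 ≤ lam)
    (ht : 0 ≤ t) (htT : t ≤ T) (hk : k ≤ n) :
    bwdWeight a b₀ b₁ lam T n k t ≤ geomBound a (b₀ + b₁ * T) lam T (n + 1) :=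
  have hT : 0 ≤ T := ht.trans htT
  (bwdWeight_le_geomBound_sub ha hb₀ hb₁ hlam ht htT hk).trans
    (geomBound_mono (by positivity) hlam hT (by omega))

lemma le_bwdWeight (ha : 0 ≤ a) (hb₀ : 0 ≤ b₀) (hb₁ : 0 ≤ b₁) (hlam : 0 ≤ lam) (hT : 0 ≤ T)
    (htT : t ≤ T) : b₀ ≤ bwdWeight a b₀ b₁ lam T n k t := by
  have hG := geomBound_nonneg (a := a) (b := b₀ + b₁ * T) (by positivity) hlam hT (n - k)
  exact le_expWeight ha hb₀ (by positivity) (by linarith)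

lemma bwdWeight_backward (ha : 0 ≤ a) (hb₀ : 0 ≤ b₀) (hb₁ : 0 ≤ b₁) (hlam : 0 ≤ lam)
    (hT : 0 ≤ T) (htT : t ≤ T) :
    b₀ + ∫ r in t..T, (a * bwdWeight a b₀ b₁ lam T n k r +
      (b₁ + lam * geomBound a (b₀ + b₁ * T) lam T (n - k))) ≤ bwdWeight a b₀ b₁ lam T n k t := by
  have hG := geomBound_nonneg (a := a) (b := b₀ + b₁ * T) (by positivity) hlam hT (n - k)
  exact expWeight_backward ha (by positivity) htT

end BwdWeight

/-- A Gronwall-type principle for bounded functions, phrased through continuous majorants. -/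
lemma le_expWeight_of_majorant {a b₀ b T s₀ M : ℝ} (ha : 0 ≤ a) (hb : 0 ≤ b) (hb₀ : 0 ≤ b₀)
    (f : ℝ → ℝ) (hM : ∀ t ∈ Set.Icc s₀ T, f t ≤ M)
    (hstep : ∀ φ : ℝ → ℝ, Continuous φ → (∀ t ∈ Set.Icc s₀ T, f t ≤ φ t) →
      ∀ t ∈ Set.Icc s₀ T, f t ≤ b₀ + ∫ s in t..T, (a * φ s + b)) :
    ∀ t ∈ Set.Icc s₀ T, f t ≤ expWeight a b₀ b (T - t) := by
  set N := max M 0 with hN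
  have hN0 : 0 ≤ N := le_max_right _ _
  have key : ∀ m : ℕ, ∀ t ∈ Set.Icc s₀ T,
      f t ≤ expWeight a b₀ b (T - t) + expWeight (2 * a) (N * (1 / 2) ^ m) 0 (T - t) := by
    intro m
    induction m with
    | zero =>
      intro t ht
      have h1 := le_expWeight ha hb₀ hb (sub_nonneg.2 ht.2)
      have h2 := le_expWeight (a := 2 * a) (b₀ := N * (1 / 2) ^ 0) (b := 0) (by positivity)
        (by positivity) le_rfl (sub_nonneg.2 ht.2)
      have h3 := hM t ht
      have h4 : M ≤ N := le_max_left _ _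
      simp only [pow_zero, mul_one] at h2 ⊢
      linarith
    | succ m ih =>
      intro t ht
      have c1 : Continuous fun t => expWeight a b₀ b (T - t) :=
        (continuous_expWeight _ _ _).comp (by fun_prop)
      have c2 : Continuous fun t => expWeight (2 * a) (N * (1 / 2) ^ m) 0 (T - t) :=
        (continuous_expWeight _ _ _).comp (by fun_prop)
      have h := hstep (fun s => expWeight a b₀ b (T - s) +
        expWeight (2 * a) (N * (1 / 2) ^ m) 0 (T - s)) (c1.add c2) ih t ht
      have h1 := expWeight_backward (b₀ := b₀) ha hb ht.2
      have h2 := expWeight_backward (a := 2 * a) (b₀ := N * (1 / 2) ^ m) (by positivity)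
        (le_refl (0 : ℝ)) ht.2
      have e : ∫ s in t..T, (a * (expWeight a b₀ b (T - s) +
            expWeight (2 * a) (N * (1 / 2) ^ m) 0 (T - s)) + b) =
          (∫ s in t..T, (a * expWeight a b₀ b (T - s) + b)) +
            (1 / 2) * ∫ s in t..T, (2 * a * expWeight (2 * a) (N * (1 / 2) ^ m) 0 (T - s) + 0) := by
        rw [← intervalIntegral.integral_const_mul, ← intervalIntegral.integral_add]
        · congr 1; ext s; ring
        · exact Continuous.intervalIntegrable (by fun_prop) _ _
        · exact Continuous.intervalIntegrable (by fun_prop) _ _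
      rw [e] at h
      have e2 : expWeight (2 * a) (N * (1 / 2) ^ (m + 1)) 0 (T - t) =
          (1 / 2) * expWeight (2 * a) (N * (1 / 2) ^ m) 0 (T - t) := by
        simp only [expWeight]; ring
      have h5 : 0 ≤ N * (1 / 2 : ℝ) ^ m := by positivity
      rw [e2]
      linarith
  intro t ht
  have hl : Filter.Tendsto (fun m : ℕ => expWeight a b₀ b (T - t) +
      expWeight (2 * a) (N * (1 / 2) ^ m) 0 (T - t)) Filter.atTop
      (nhds (expWeight a b₀ b (T - t) + 0)) := by
    refine tendsto_const_nhds.add ?_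
    have h := ((tendsto_pow_atTop_nhds_zero_of_lt_one (by norm_num : (0 : ℝ) ≤ 1 / 2)
      (by norm_num)).const_mul N).const_mul (Real.exp (2 * a * (T - t)))
    simpa [expWeight] using h
  simpa using ge_of_tendsto' hl fun m => key m t ht

lemma sum_abs_vecMul_sub_le {S : ℕ} {m₁ m₂ : Fin S → ℝ} {B₁ B₂ : Fin S → Fin S → ℝ} {q d : ℝ}
    (hm : m₁ ∈ simplex S) (hB : ∀ j, ∑ i, |B₂ j i| ≤ q)
    (hd : ∀ j, ∑ i, |B₁ j i - B₂ j i| ≤ d) :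
    ∑ i, |∑ j, m₁ j * B₁ j i - ∑ j, m₂ j * B₂ j i| ≤ q * ∑ j, |m₁ j - m₂ j| + d := by
  calc ∑ i, |∑ j, m₁ j * B₁ j i - ∑ j, m₂ j * B₂ j i|
      ≤ ∑ i, ∑ j, (|m₁ j - m₂ j| * |B₂ j i| + m₁ j * |B₁ j i - B₂ j i|) := by
        refine Finset.sum_le_sum fun i _ => ?_
        rw [← Finset.sum_sub_distrib]
        refine (Finset.abs_sum_le_sum_abs _ _).trans (Finset.sum_le_sum fun j _ => ?_)
        rw [show m₁ j * B₁ j i - m₂ j * B₂ j i =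
          (m₁ j - m₂ j) * B₂ j i + m₁ j * (B₁ j i - B₂ j i) by ring]
        refine (abs_add_le _ _).trans ?_
        rw [abs_mul, abs_mul, abs_of_nonneg (hm.1 j)]
    _ = ∑ j, (|m₁ j - m₂ j| * ∑ i, |B₂ j i| + m₁ j * ∑ i, |B₁ j i - B₂ j i|) := by
        rw [Finset.sum_comm]
        simp only [Finset.sum_add_distrib, Finset.mul_sum]
    _ ≤ ∑ j, (|m₁ j - m₂ j| * q + m₁ j * d) := by
        refine Finset.sum_le_sum fun j _ => ?_
        have := hm.1 j
        have := hB j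
        have := hd j
        gcongr
    _ = q * ∑ j, |m₁ j - m₂ j| + d := by
        rw [Finset.sum_add_distrib, ← Finset.sum_mul, ← Finset.sum_mul, hm.2]
        ring

lemma sum_abs_integral_le {S : ℕ} {f : Fin S → ℝ → ℝ} {g : ℝ → ℝ} {s t : ℝ} (hst : s ≤ t)
    (hf : ∀ i, IntervalIntegrable (f i) volume s t) (hg : IntervalIntegrable g volume s t)
    (h : ∀ r ∈ Set.Icc s t, ∑ i, |f i r| ≤ g r) :
    ∑ i, |∫ r in s..t, f i r| ≤ ∫ r in s..t, g r := by
  calc ∑ i, |∫ r in s..t, f i r| ≤ ∑ i, ∫ r in s..t, |f i r| :=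
        Finset.sum_le_sum fun i _ => intervalIntegral.abs_integral_le_integral_abs hst
    _ = ∫ r in s..t, ∑ i, |f i r| :=
        (intervalIntegral.integral_finsetSum fun i _ => (hf i).abs).symm
    _ ≤ ∫ r in s..t, g r := by
        refine intervalIntegral.integral_mono_on hst ?_ hg h
        simpa only [Finset.sum_fn] using
          IntervalIntegrable.sum Finset.univ fun i (_ : i ∈ Finset.univ) => (hf i).abs

lemma abs_integral_le_of_le {f g : ℝ → ℝ} {s t : ℝ} (hst : s ≤ t)
    (hf : IntervalIntegrable f volume s t) (hg : IntervalIntegrable g volume s t)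
    (h : ∀ r ∈ Set.Icc s t, |f r| ≤ g r) : |∫ r in s..t, f r| ≤ ∫ r in s..t, g r :=
  (intervalIntegral.abs_integral_le_integral_abs hst).trans
    (intervalIntegral.integral_mono_on hst hf.abs hg h)

lemma intervalIntegrable_of_bounded {f : ℝ → ℝ} {s t C : ℝ} (hf : Measurable f) (hst : s ≤ t)
    (h : ∀ r ∈ Set.Icc s t, |f r| ≤ C) : IntervalIntegrable f volume s t := by
  rw [intervalIntegrable_iff_integrableOn_Ioc_of_le hst]
  refine Measure.integrableOn_of_bounded (M := C) (by simp) hf.aestronglyMeasurable ?_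
  exact (ae_restrict_iff' measurableSet_Ioc).2 (Filter.Eventually.of_forall fun r hr =>
    h r ⟨hr.1.le, hr.2⟩)

/-- Variation of constants: the integrating-factor form of a linear equation implies the
integral form. -/
lemma eq_add_integral_of_variation_of_constants {q x₀ s t : ℝ} {g x : ℝ → ℝ} (hst : s ≤ t)
    (hg : IntervalIntegrable g volume s t)
    (hx : ∀ τ ∈ Set.Icc s t, x τ = Real.exp (-(q * (τ - s))) * x₀ +
      ∫ r in s..τ, Real.exp (-(q * (τ - r))) * g r) :
    x t = x₀ + ∫ r in s..t, (g r - q * x r) := by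
  set f : ℝ → ℝ := fun τ => Real.exp (-(q * (τ - s))) with hf
  set G : ℝ → ℝ := fun r => Real.exp (q * (r - s)) * g r with hG
  have hGi : IntervalIntegrable G volume s t :=
    hg.continuousOn_mul (Continuous.continuousOn (by fun_prop))
  set Y : ℝ → ℝ := fun τ => x₀ + ∫ r in s..τ, G r with hY
  have hxf : ∀ τ ∈ Set.Icc s t, x τ = f τ * Y τ := by
    intro τ hτ
    rw [hx τ hτ]
    simp only [hf, hY, hG, mul_add]
    rw [← intervalIntegral.integral_const_mul]
    congr 2; ext r
    rw [← mul_assoc, ← Real.exp_add]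
    congr 2; ring
  have hfd : ∀ τ, HasDerivAt f (-q * f τ) τ := by
    intro τ
    have := ((((hasDerivAt_id τ).sub_const s).const_mul q).neg).exp
    refine HasDerivAt.congr_deriv (f := f) this ?_
    simp only [hf, Pi.neg_apply, id]; ring
  have hfac : AbsolutelyContinuousOnInterval f s t := by
    refine ContDiffOn.absolutelyContinuousOnInterval (ContDiff.contDiffOn ?_)
    simp only [hf]; fun_prop
  have hYac : AbsolutelyContinuousOnInterval Y s t := by
    have h0 : AbsolutelyContinuousOnInterval (fun _ : ℝ => x₀) s t :=
      (contDiff_const (n := 1)).contDiffOn.absolutelyContinuousOnInterval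
    exact h0.add (hGi.absolutelyContinuousOnInterval_intervalIntegral (c := s) (by simp))
  have hibp := hfac.integral_deriv_mul_eq_sub hYac
  have hfs : f s = 1 := by simp [hf]
  have hYs : Y s = x₀ := by simp [hY]
  rw [← hxf t ⟨hst, le_rfl⟩, hfs, hYs, one_mul] at hibp
  have : ∫ r in s..t, (g r - q * x r) = ∫ r in s..t, (deriv f r * Y r + f r * deriv Y r) := by
    refine intervalIntegral.integral_congr_ae ?_
    filter_upwards [hGi.ae_hasDerivAt_integral] with r hr hr'
    have hr2 : r ∈ Set.uIcc s t := Set.uIoc_subset_uIcc hr'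
    have hY' : HasDerivAt Y (G r) r := (hr hr2 s (by simp)).const_add x₀
    rw [Set.uIcc_of_le hst] at hr2
    rw [hY'.deriv, (hfd r).deriv, hxf r hr2]
    have : f r * G r = g r := by
      simp only [hf, hG]
      rw [← mul_assoc, ← Real.exp_add]
      simp
    rw [this]; ring
  rw [this, hibp]; ring

lemma absContOn_of_lipschitz {E : Type*} [NormedAddCommGroup E] {f : ℝ → E} {a b K : ℝ}
    (hK : 0 ≤ K) (h : ∀ s t, a ≤ s → s ≤ t → t ≤ b → ‖f t - f s‖ ≤ K * (t - s)) :
    AbsContOn f a b := by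
  intro ε hε
  refine ⟨ε / (K + 1), by positivity, fun N c d hcd _ hsum => ?_⟩
  calc ∑ k, ‖f (d k) - f (c k)‖ ≤ ∑ k, K * (d k - c k) :=
        Finset.sum_le_sum fun k _ => h _ _ (hcd k).1 (hcd k).2.1 (hcd k).2.2
    _ = K * ∑ k, (d k - c k) := by rw [Finset.mul_sum]
    _ ≤ (K + 1) * ∑ k, (d k - c k) := by
        have : 0 ≤ ∑ k, (d k - c k) := Finset.sum_nonneg fun k _ => by linarith [(hcd k).2.1]
        nlinarith
    _ < ε := by rwa [lt_div_iff₀ (by positivity), mul_comm] at hsum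

lemma norm_sub_le_sum_abs {S : ℕ} (x y : Fin S → ℝ) : ‖x - y‖ ≤ ∑ i, |x i - y i| :=
  (pi_norm_le_iff_of_nonneg (Finset.sum_nonneg fun _ _ => abs_nonneg _)).2 fun i =>
    Finset.single_le_sum (f := fun i => |x i - y i|) (fun _ _ => abs_nonneg _) (Finset.mem_univ i)

section States

variable {n : ℕ} {T t s : ℝ} {u : Fin n → ℝ}

lemma Zu_eq_of_forall {k : ℕ} (hk : k ≤ n) (h₁ : ∀ i : Fin n, (i : ℕ) < k → 0 ≤ u i)
    (h₂ : ∀ i : Fin n, k ≤ (i : ℕ) → u i = -1) : Zu u = k := by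
  have : (Finset.univ.filter fun i : Fin n => u i ≠ -1) =
      Finset.univ.filter fun i : Fin n => (i : ℕ) < k := by
    ext i
    simp only [Finset.mem_filter, Finset.mem_univ, true_and]
    constructor
    · intro h
      by_contra h'
      exact h (h₂ i (not_lt.1 h'))
    · intro h h'
      have := h₁ i h
      linarith
  rw [Zu, this, Fin.card_filter_val_lt, min_eq_right hk]

lemma memU.spec (hu : memU n T u) : Zu u ≤ n ∧
    (∀ i : Fin n, (i : ℕ) < Zu u → u i ∈ Set.Icc (0 : ℝ) T) ∧
    (∀ i j : Fin n, (j : ℕ) < Zu u → i ≤ j → u i ≤ u j) ∧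
    (∀ i : Fin n, Zu u ≤ (i : ℕ) → u i = -1) := by
  obtain ⟨k, hk, h₁, h₂, h₃⟩ := hu
  rw [Zu_eq_of_forall hk (fun i hi => (h₁ i hi).1) h₃]
  exact ⟨hk, h₁, h₂, h₃⟩

lemma memU.Zu_le (hu : memU n T u) : Zu u ≤ n := hu.spec.1

lemma memU.startTime_mem (hT : 0 ≤ T) (hu : memU n T u) : startTime u ∈ Set.Icc (0 : ℝ) T := by
  obtain ⟨h₀, h₁, -, -⟩ := hu.spec
  unfold startTime lastTime
  split_ifs with h h'
  · exact ⟨le_rfl, hT⟩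
  · exact h₁ _ (by simp only; omega)
  · exact ⟨le_rfl, hT⟩

lemma startTime_of_pos (h : 1 ≤ Zu u) : startTime u = lastTime u := by
  rw [startTime, if_neg (by omega)]

lemma memTS_iff (hT : 0 ≤ T) (hu : memU n T u) :
    memTS n T t u ↔ startTime u ≤ t ∧ t ≤ T := by
  obtain ⟨h₀, h₁, h₂, h₃⟩ := hu.spec
  constructor
  · rintro ⟨-, ht, h⟩
    refine ⟨?_, ht.2⟩
    unfold startTime lastTime
    split_ifs with h5 h6
    exacts [ht.1, h _, ht.1]
  · rintro ⟨h, hT'⟩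
    have h0 := (hu.startTime_mem hT).1
    refine ⟨hu, ⟨h0.trans h, hT'⟩, fun i => ?_⟩
    rcases lt_or_ge (i : ℕ) (Zu u) with hi | hi
    · refine le_trans ?_ h
      have hz : Zu u - 1 < n := by omega
      rw [startTime_of_pos (by omega), lastTime, dif_pos hz]
      exact h₂ _ _ (by simp only; omega) (Fin.le_def.2 (by simp only; omega))
    · rw [h₃ i hi]; linarith

lemma memTS_startTime (hT : 0 ≤ T) (hu : memU n T u) : memTS n T (startTime u) u :=
  (memTS_iff hT hu).2 ⟨le_rfl, (hu.startTime_mem hT).2⟩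

lemma memTS_end (hT : 0 ≤ T) (hu : memU n T u) : memTS n T T u :=
  (memTS_iff hT hu).2 ⟨(hu.startTime_mem hT).2, le_rfl⟩

lemma memTS.of_le (h : memTS n T t u) (hts : t ≤ s) (hs : s ≤ T) : memTS n T s u :=
  ⟨h.1, ⟨h.2.1.1.trans hts, hs⟩, fun i => (h.2.2 i).trans hts⟩

lemma memTS.push (h : memTS n T s u) (hZ : Zu u < n) :
    memTS n T s (push u s) ∧ Zu (push u s) = Zu u + 1 := by
  obtain ⟨hu, hs, hle⟩ := h
  obtain ⟨h₀, h₁, h₂, h₃⟩ := hu.spec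
  have g₁ : ∀ i : Fin n, (i : ℕ) < Zu u + 1 → MFGShocks.push u s i ∈ Set.Icc (0 : ℝ) T := by
    intro i hi
    unfold MFGShocks.push
    split_ifs with h
    · exact hs
    · exact h₁ i (by omega)
  have g₃ : ∀ i : Fin n, Zu u + 1 ≤ (i : ℕ) → MFGShocks.push u s i = -1 := by
    intro i hi
    unfold MFGShocks.push
    rw [if_neg (by omega)]
    exact h₃ i (by omega)
  refine ⟨⟨⟨Zu u + 1, hZ, g₁, ?_, g₃⟩, hs, ?_⟩,
    Zu_eq_of_forall hZ (fun i hi => (g₁ i hi).1) g₃⟩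
  · intro i j hj hij
    have hij' : (i : ℕ) ≤ j := hij
    unfold MFGShocks.push
    split_ifs with h h' h'
    · exact le_rfl
    · omega
    · exact hle i
    · exact h₂ i j (by omega) hij
  · intro i
    unfold MFGShocks.push
    split_ifs with h
    · exact le_rfl
    · exact hle i

lemma memU.pop (hT : 0 ≤ T) (hu : memU n T u) (hZ : 1 ≤ Zu u) :
    memTS n T (startTime u) (pop u) ∧ Zu (pop u) = Zu u - 1 := by
  obtain ⟨h₀, h₁, h₂, h₃⟩ := hu.spec
  have g₁ : ∀ i : Fin n, (i : ℕ) < Zu u - 1 → MFGShocks.pop u i = u i := by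
    intro i hi
    rw [MFGShocks.pop, if_neg (by omega)]
  have g₃ : ∀ i : Fin n, Zu u - 1 ≤ (i : ℕ) → MFGShocks.pop u i = -1 := by
    intro i hi
    unfold MFGShocks.pop
    split_ifs with h
    · rfl
    · exact h₃ i (by omega)
  have hs := hu.startTime_mem hT
  refine ⟨⟨⟨Zu u - 1, by omega, ?_, ?_, g₃⟩, hs, ?_⟩, Zu_eq_of_forall (by omega) ?_ g₃⟩
  · intro i hi
    rw [g₁ i hi]
    exact h₁ i (by omega)
  · intro i j hj hij
    have hij' : (i : ℕ) ≤ j := hij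
    rw [g₁ i (by omega), g₁ j hj]
    exact h₂ i j (by omega) hij
  · intro i
    rcases lt_or_ge (i : ℕ) (Zu u - 1) with hi | hi
    · rw [g₁ i hi]
      exact (memTS_startTime hT hu).2.2 i
    · rw [g₃ i hi]; linarith [hs.1]
  · intro i hi
    rw [g₁ i hi]
    exact (h₁ i (by omega)).1

lemma memU.eq_neg_one (hu : memU n T u) (hZ : Zu u = 0) : u = fun _ => (-1 : ℝ) := by
  ext i
  exact hu.spec.2.2.2 i (by omega)

lemma Zu_neg_one : Zu (fun _ : Fin n => (-1 : ℝ)) = 0 := by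
  simp [Zu]

lemma memU_neg_one : memU n T fun _ => (-1 : ℝ) :=
  ⟨0, by simp, by simp, by simp, by simp⟩

lemma memTS_neg_one (hT : 0 ≤ T) : memTS n T 0 fun _ => (-1 : ℝ) :=
  ⟨memU_neg_one, ⟨le_rfl, hT⟩, fun _ => by norm_num⟩

end States

section Measurability

variable {n : ℕ}

lemma measurable_Zu : Measurable (Zu : (Fin n → ℝ) → ℕ) := by
  have : (Zu : (Fin n → ℝ) → ℕ) = fun u => ∑ i, if u i ≠ -1 then 1 else 0 := by
    ext u; simp only [Zu, Finset.card_filter]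
  rw [this]
  refine Finset.measurable_sum _ fun i _ => Measurable.ite ?_ measurable_const measurable_const
  exact (measurableSet_eq_fun (measurable_pi_apply i) measurable_const).compl

lemma measurable_push : Measurable fun p : ℝ × (Fin n → ℝ) => push p.2 p.1 := by
  refine measurable_pi_lambda _ fun i => ?_
  refine Measurable.ite ?_ measurable_fst (by fun_prop)
  exact measurableSet_eq_fun measurable_const (measurable_Zu.comp measurable_snd)

lemma measurable_pop : Measurable (pop : (Fin n → ℝ) → Fin n → ℝ) := by
  refine measurable_pi_lambda _ fun i => ?_
  refine Measurable.ite ?_ measurable_const (by fun_prop)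
  exact measurableSet_eq_fun measurable_const measurable_Zu

lemma measurable_startTime : Measurable (startTime : (Fin n → ℝ) → ℝ) := by
  have : (startTime : (Fin n → ℝ) → ℝ) = (fun p : (Fin n → ℝ) × ℕ =>
      if p.2 = 0 then 0 else if h : p.2 - 1 < n then p.1 ⟨p.2 - 1, h⟩ else 0) ∘
        fun u => (u, Zu u) := by
    ext u; rfl
  rw [this]
  refine Measurable.comp (measurable_from_prod_countable_left fun k => ?_)
    (measurable_id.prodMk measurable_Zu)
  simp only
  split_ifs with h h'
  exacts [measurable_const, measurable_pi_apply (⟨k - 1, h'⟩ : Fin n), measurable_const]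

lemma measurable_intervalIntegral_param {α : Type*} [MeasurableSpace α] {f : α → ℝ → ℝ}
    {a b : α → ℝ} (hf : Measurable fun p : α × ℝ => f p.1 p.2) (ha : Measurable a)
    (hb : Measurable b) : Measurable fun x => ∫ s in a x..b x, f x s := by
  have key : ∀ {a b : α → ℝ}, Measurable a → Measurable b →
      Measurable fun x => ∫ s in Set.Ioc (a x) (b x), f x s := by
    intro a b ha hb
    have e : (fun x => ∫ s in Set.Ioc (a x) (b x), f x s) =
        fun x => ∫ s, Set.indicator {p : α × ℝ | a p.1 < p.2 ∧ p.2 ≤ b p.1}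
          (fun p => f p.1 p.2) (x, s) := by
      ext x
      rw [← integral_indicator measurableSet_Ioc]
      rfl
    rw [e]
    have hs : MeasurableSet {p : α × ℝ | a p.1 < p.2 ∧ p.2 ≤ b p.1} :=
      (measurableSet_lt (ha.comp measurable_fst) measurable_snd).inter
        (measurableSet_le measurable_snd (hb.comp measurable_fst))
    exact ((hf.indicator hs).stronglyMeasurable.integral_prod_right').measurable
  exact (key ha hb).sub (key hb ha)

end Measurability

section Estimates

variable {S n : ℕ} {T : ℝ} {D : Model S n}
  {Lpsi LQ LPsi Llam Psimax psimax Qmax lammax : ℝ} {Jmax : ℕ}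

lemma Hyps.nonempty (H : Hyps S n T D Lpsi LQ LPsi Llam Psimax psimax Qmax lammax Jmax) :
    Nonempty (Fin S) :=
  ⟨⟨0, H.hS⟩⟩

lemma Hyps.bounds_nonneg (H : Hyps S n T D Lpsi LQ LPsi Llam Psimax psimax Qmax lammax Jmax) :
    0 ≤ Psimax ∧ 0 ≤ psimax ∧ 0 ≤ Qmax ∧ 0 ≤ lammax := by
  obtain ⟨i⟩ := H.nonempty
  have hu := memTS_neg_one (n := n) H.hT.le
  refine ⟨?_, ?_, ?_, ?_⟩
  · exact (abs_nonneg _).trans (H.Psi_bdd 0 (Nat.zero_le _) _ H.hm0 i)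
  · exact (abs_nonneg _).trans (H.psi_bdd _ _ _ 0 hu H.hm0 i)
  · exact (Finset.sum_nonneg fun _ _ => abs_nonneg _).trans (H.Q_bdd _ _ _ 0 hu H.hm0 i)
  · exact (H.lam_pos 1 le_rfl H.hn 0 hu.2.1 _ H.hm0).le.trans
      (H.lam_bdd 1 le_rfl H.hn 0 hu.2.1 _ H.hm0)

lemma Hyps.lam_nonneg (H : Hyps S n T D Lpsi LQ LPsi Llam Psimax psimax Qmax lammax Jmax)
    {s : ℝ} {u : Fin n → ℝ} (hs : memTS n T s u) (hZ : Zu u < n) {m : Fin S → ℝ}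
    (hm : m ∈ simplex S) :
    0 ≤ D.lam (Zu u + 1) s m ∧ D.lam (Zu u + 1) s m ≤ lammax :=
  ⟨(H.lam_pos _ (by omega) hZ s hs.2.1 m hm).le, H.lam_bdd _ (by omega) hZ s hs.2.1 m hm⟩

lemma abs_sum_mul_le {q x : ℝ} {A w : Fin S → ℝ} (hx : 0 ≤ x) (hA : ∑ j, |A j| ≤ q)
    (hw : ∀ j, |w j| ≤ x) : |∑ j, A j * w j| ≤ q * x := by
  calc |∑ j, A j * w j| ≤ ∑ j, |A j| * |w j| := by
        simpa only [abs_mul] using Finset.abs_sum_le_sum_abs (fun j => A j * w j) Finset.univ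
    _ ≤ ∑ j, |A j| * x :=
        Finset.sum_le_sum fun j _ => mul_le_mul_of_nonneg_left (hw j) (abs_nonneg _)
    _ = (∑ j, |A j|) * x := by rw [Finset.sum_mul]
    _ ≤ q * x := by gcongr

variable {μ v μ₁ μ₂ v₁ v₂ : ℝ → (Fin n → ℝ) → Fin S → ℝ} {u : Fin n → ℝ} {s : ℝ}

lemma abs_E1rhs_le (H : Hyps S n T D Lpsi LQ LPsi Llam Psimax psimax Qmax lammax Jmax)
    (hs : memTS n T s u) (hμ : μ s u ∈ simplex S) {x y : ℝ} (hx : ∀ i, |v s u i| ≤ x)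
    (hy : Zu u < n → ∀ i, |v s (push u s) i| ≤ y) (hy₀ : 0 ≤ y) (i : Fin S) :
    |E1rhs D μ v u i s| ≤ psimax + (Qmax + lammax) * x + lammax * y := by
  obtain ⟨-, -, -, hlam⟩ := H.bounds_nonneg
  have hx₀ : 0 ≤ x := (abs_nonneg _).trans (hx i)
  have h₁ := H.psi_bdd s u _ (v s u) hs hμ i
  have h₂ := abs_sum_mul_le hx₀ (H.Q_bdd s u _ (v s u) hs hμ i) hx
  have h₃ : |(if Zu u < n then
      D.lam (Zu u + 1) s (μ s u) * (v s (push u s) (D.J s i) - v s u i) else 0)| ≤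
      lammax * (y + x) := by
    split_ifs with hZ
    · obtain ⟨l₀, l₁⟩ := H.lam_nonneg hs hZ hμ
      rw [abs_mul, abs_of_nonneg l₀]
      refine mul_le_mul l₁ ((abs_sub _ _).trans (add_le_add (hy hZ _) (hx i))) (abs_nonneg _) hlam
    · rw [abs_zero]; positivity
  have := abs_add_three (D.psi s u (μ s u) (v s u) i) (∑ j, D.Q s u (μ s u) (v s u) i j * v s u j)
    (if Zu u < n then D.lam (Zu u + 1) s (μ s u) * (v s (push u s) (D.J s i) - v s u i) else 0)
  unfold E1rhs
  linarith

lemma abs_E1rhs_sub_le (H : Hyps S n T D Lpsi LQ LPsi Llam Psimax psimax Qmax lammax Jmax)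
    (hs : memTS n T s u) (hμ₁ : μ₁ s u ∈ simplex S) (hμ₂ : μ₂ s u ∈ simplex S)
    {V δ x y : ℝ} (hv : ∀ i, |v₁ s u i| ≤ V) (hw : Zu u < n → ∀ i, |v₁ s (push u s) i| ≤ V)
    (hδ : ∑ i, |μ₁ s u i - μ₂ s u i| ≤ δ) (hx : ∀ i, |v₁ s u i - v₂ s u i| ≤ x)
    (hy : Zu u < n → ∀ i, |v₁ s (push u s) i - v₂ s (push u s) i| ≤ y) (hy₀ : 0 ≤ y)
    (i : Fin S) :
    |E1rhs D μ₁ v₁ u i s - E1rhs D μ₂ v₂ u i s| ≤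
      (Lpsi + LQ * V + 2 * V * Llam) * δ + (Lpsi + V * LQ + Qmax + lammax) * x + lammax * y := by
  obtain ⟨-, -, hQ, hlam⟩ := H.bounds_nonneg
  have hLpsi := H.hLpsi
  have hLQ := H.hLQ
  have hLlam := H.hLlam
  have hx₀ : 0 ≤ x := (abs_nonneg _).trans (hx i)
  have hV₀ : 0 ≤ V := (abs_nonneg _).trans (hv i)
  have hnμ : ‖μ₁ s u - μ₂ s u‖ ≤ δ := (norm_sub_le_sum_abs _ _).trans hδ
  have hδ₀ : 0 ≤ δ := (norm_nonneg _).trans hnμ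
  have hnv : ‖v₁ s u - v₂ s u‖ ≤ x := (pi_norm_le_iff_of_nonneg hx₀).2 hx
  have h₁ : |D.psi s u (μ₁ s u) (v₁ s u) i - D.psi s u (μ₂ s u) (v₂ s u) i| ≤ Lpsi * (δ + x) :=
    (H.psi_lip s u hs _ hμ₁ _ hμ₂ _ _ i).trans (by gcongr)
  have h₂ : |∑ j, (D.Q s u (μ₁ s u) (v₁ s u) i j - D.Q s u (μ₂ s u) (v₂ s u) i j) * v₁ s u j| ≤
      LQ * (δ + x) * V :=
    abs_sum_mul_le hV₀ ((H.Q_lip s u hs _ hμ₁ _ hμ₂ _ _ i).trans (by gcongr)) hv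
  have h₃ : |∑ j, D.Q s u (μ₂ s u) (v₂ s u) i j * (v₁ s u j - v₂ s u j)| ≤ Qmax * x :=
    abs_sum_mul_le hx₀ (H.Q_bdd s u _ _ hs hμ₂ i) hx
  have h₄ : |(if Zu u < n then
        D.lam (Zu u + 1) s (μ₁ s u) * (v₁ s (push u s) (D.J s i) - v₁ s u i) else 0) -
      (if Zu u < n then
        D.lam (Zu u + 1) s (μ₂ s u) * (v₂ s (push u s) (D.J s i) - v₂ s u i) else 0)| ≤
      Llam * δ * (V + V) + lammax * (y + x) := by
    split_ifs with hZ
    · obtain ⟨l₀, l₁⟩ := H.lam_nonneg hs hZ hμ₂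
      have hl : |D.lam (Zu u + 1) s (μ₁ s u) - D.lam (Zu u + 1) s (μ₂ s u)| ≤ Llam * δ :=
        (H.lam_lip _ (by omega) hZ s hs.2.1 _ hμ₁ _ hμ₂).trans (by gcongr)
      have e : D.lam (Zu u + 1) s (μ₁ s u) * (v₁ s (push u s) (D.J s i) - v₁ s u i) -
          D.lam (Zu u + 1) s (μ₂ s u) * (v₂ s (push u s) (D.J s i) - v₂ s u i) =
          (D.lam (Zu u + 1) s (μ₁ s u) - D.lam (Zu u + 1) s (μ₂ s u)) *
            (v₁ s (push u s) (D.J s i) - v₁ s u i) +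
          D.lam (Zu u + 1) s (μ₂ s u) *
            ((v₁ s (push u s) (D.J s i) - v₂ s (push u s) (D.J s i)) -
              (v₁ s u i - v₂ s u i)) := by ring
      rw [e]
      refine (abs_add_le _ _).trans (add_le_add ?_ ?_)
      · rw [abs_mul]
        exact mul_le_mul hl ((abs_sub _ _).trans (add_le_add (hw hZ _) (hv i))) (abs_nonneg _)
          (by positivity)
      · rw [abs_mul, abs_of_nonneg l₀]
        exact mul_le_mul l₁ ((abs_sub _ _).trans (add_le_add (hy hZ _) (hx i))) (abs_nonneg _) hlam
    · rw [sub_self, abs_zero]; positivity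
  have e : E1rhs D μ₁ v₁ u i s - E1rhs D μ₂ v₂ u i s =
      (D.psi s u (μ₁ s u) (v₁ s u) i - D.psi s u (μ₂ s u) (v₂ s u) i) +
      (∑ j, (D.Q s u (μ₁ s u) (v₁ s u) i j - D.Q s u (μ₂ s u) (v₂ s u) i j) * v₁ s u j +
      ∑ j, D.Q s u (μ₂ s u) (v₂ s u) i j * (v₁ s u j - v₂ s u j)) +
      ((if Zu u < n then
        D.lam (Zu u + 1) s (μ₁ s u) * (v₁ s (push u s) (D.J s i) - v₁ s u i) else 0) -
      (if Zu u < n then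
        D.lam (Zu u + 1) s (μ₂ s u) * (v₂ s (push u s) (D.J s i) - v₂ s u i) else 0)) := by
    rw [← Finset.sum_add_distrib]
    unfold E1rhs
    have : ∀ j, (D.Q s u (μ₁ s u) (v₁ s u) i j - D.Q s u (μ₂ s u) (v₂ s u) i j) * v₁ s u j +
        D.Q s u (μ₂ s u) (v₂ s u) i j * (v₁ s u j - v₂ s u j) =
        D.Q s u (μ₁ s u) (v₁ s u) i j * v₁ s u j - D.Q s u (μ₂ s u) (v₂ s u) i j * v₂ s u j :=
      fun j => by ring
    simp only [this, Finset.sum_sub_distrib]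
    ring
  rw [e]
  refine (abs_add_three _ _ _).trans ?_
  have := abs_add_le
    (∑ j, (D.Q s u (μ₁ s u) (v₁ s u) i j - D.Q s u (μ₂ s u) (v₂ s u) i j) * v₁ s u j)
    (∑ j, D.Q s u (μ₂ s u) (v₂ s u) i j * (v₁ s u j - v₂ s u j))
  linarith

lemma abs_E2rhs_le (H : Hyps S n T D Lpsi LQ LPsi Llam Psimax psimax Qmax lammax Jmax)
    (hs : memTS n T s u) (hμ : μ s u ∈ simplex S) (i : Fin S) :
    |E2rhs D v μ u i s| ≤ Qmax := by
  unfold E2rhs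
  calc |∑ j, μ s u j * D.Q s u (μ s u) (v s u) j i|
      ≤ ∑ j, |μ s u j * D.Q s u (μ s u) (v s u) j i| := Finset.abs_sum_le_sum_abs _ _
    _ ≤ ∑ j, μ s u j * Qmax := by
        refine Finset.sum_le_sum fun j _ => ?_
        rw [abs_mul, abs_of_nonneg (hμ.1 j)]
        refine mul_le_mul_of_nonneg_left ?_ (hμ.1 j)
        exact (Finset.single_le_sum (f := fun i => |D.Q s u (μ s u) (v s u) j i|)
          (fun _ _ => abs_nonneg _) (Finset.mem_univ i)).trans (H.Q_bdd s u _ _ hs hμ j)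
    _ = Qmax := by rw [← Finset.sum_mul, hμ.2, one_mul]

lemma sum_E2rhs (H : Hyps S n T D Lpsi LQ LPsi Llam Psimax psimax Qmax lammax Jmax) :
    ∑ i, E2rhs D v μ u i s = 0 := by
  unfold E2rhs
  rw [Finset.sum_comm]
  simp [← Finset.mul_sum, H.Q_rowsum]

/-- The forward right-hand side shifted by `Qmax`, which preserves nonnegativity. -/
noncomputable def shiftedE2rhs (D : Model S n) (Qmax : ℝ)
    (v μ : ℝ → (Fin n → ℝ) → Fin S → ℝ) (u : Fin n → ℝ) (i : Fin S) (s : ℝ) : ℝ :=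
  E2rhs D v μ u i s + Qmax * μ s u i

lemma shiftedE2rhs_eq (D : Model S n) (Qmax : ℝ)
    (v μ : ℝ → (Fin n → ℝ) → Fin S → ℝ) (u : Fin n → ℝ) (i : Fin S) (s : ℝ) :
    shiftedE2rhs D Qmax v μ u i s =
      ∑ j, μ s u j * (D.Q s u (μ s u) (v s u) j i + if j = i then Qmax else 0) := by
  simp only [shiftedE2rhs, E2rhs, mul_add, Finset.sum_add_distrib, mul_ite, mul_zero,
    Finset.sum_ite_eq', Finset.mem_univ, if_true]
  ring

lemma Hyps.shifted_nonneg
    (H : Hyps S n T D Lpsi LQ LPsi Llam Psimax psimax Qmax lammax Jmax)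
    (hs : memTS n T s u) {m w : Fin S → ℝ} (hm : m ∈ simplex S) (j i : Fin S) :
    0 ≤ D.Q s u m w j i + if j = i then Qmax else 0 := by
  split_ifs with h
  · subst h
    have h₁ := Finset.single_le_sum (f := fun i => |D.Q s u m w j i|)
      (fun _ _ => abs_nonneg _) (Finset.mem_univ j)
    have h₂ := H.Q_bdd s u m w hs hm j
    have h₃ := neg_abs_le (D.Q s u m w j j)
    linarith
  · simpa using H.Q_offdiag s u m w j i h

lemma shiftedE2rhs_nonneg
    (H : Hyps S n T D Lpsi LQ LPsi Llam Psimax psimax Qmax lammax Jmax)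
    (hs : memTS n T s u) (hμ : μ s u ∈ simplex S) (i : Fin S) :
    0 ≤ shiftedE2rhs D Qmax v μ u i s := by
  rw [shiftedE2rhs_eq]
  exact Finset.sum_nonneg fun j _ => mul_nonneg (hμ.1 j) (H.shifted_nonneg hs hμ j i)

lemma sum_shiftedE2rhs
    (H : Hyps S n T D Lpsi LQ LPsi Llam Psimax psimax Qmax lammax Jmax)
    (hμ : μ s u ∈ simplex S) : ∑ i, shiftedE2rhs D Qmax v μ u i s = Qmax := by
  simp only [shiftedE2rhs, Finset.sum_add_distrib, sum_E2rhs H, ← Finset.mul_sum, hμ.2]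
  ring

lemma abs_shiftedE2rhs_le
    (H : Hyps S n T D Lpsi LQ LPsi Llam Psimax psimax Qmax lammax Jmax)
    (hs : memTS n T s u) (hμ : μ s u ∈ simplex S) (i : Fin S) :
    |shiftedE2rhs D Qmax v μ u i s| ≤ Qmax := by
  rw [abs_of_nonneg (shiftedE2rhs_nonneg H hs hμ i)]
  exact (Finset.single_le_sum (f := fun i => shiftedE2rhs D Qmax v μ u i s)
    (fun i _ => shiftedE2rhs_nonneg H hs hμ i) (Finset.mem_univ i)).trans_eq
      (sum_shiftedE2rhs H hμ)

section Difference

variable {δ x : ℝ}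

lemma Hyps.sum_abs_Q_sub_le
    (H : Hyps S n T D Lpsi LQ LPsi Llam Psimax psimax Qmax lammax Jmax)
    (hs : memTS n T s u) (hμ₁ : μ₁ s u ∈ simplex S) (hμ₂ : μ₂ s u ∈ simplex S)
    (hδ : ∑ i, |μ₁ s u i - μ₂ s u i| ≤ δ) (hx : ∀ i, |v₁ s u i - v₂ s u i| ≤ x) (j : Fin S) :
    ∑ i, |D.Q s u (μ₁ s u) (v₁ s u) j i - D.Q s u (μ₂ s u) (v₂ s u) j i| ≤ LQ * (δ + x) := by
  have hx₀ : 0 ≤ x := (abs_nonneg _).trans (hx j)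
  have hnv : ‖v₁ s u - v₂ s u‖ ≤ x := (pi_norm_le_iff_of_nonneg hx₀).2 hx
  have hnμ : ‖μ₁ s u - μ₂ s u‖ ≤ δ := (norm_sub_le_sum_abs _ _).trans hδ
  have := H.hLQ
  exact (H.Q_lip s u hs _ hμ₁ _ hμ₂ _ _ j).trans (by gcongr)

lemma sum_abs_E2rhs_sub_le
    (H : Hyps S n T D Lpsi LQ LPsi Llam Psimax psimax Qmax lammax Jmax)
    (hs : memTS n T s u) (hμ₁ : μ₁ s u ∈ simplex S) (hμ₂ : μ₂ s u ∈ simplex S)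
    (hδ : ∑ i, |μ₁ s u i - μ₂ s u i| ≤ δ) (hx : ∀ i, |v₁ s u i - v₂ s u i| ≤ x) :
    ∑ i, |E2rhs D v₁ μ₁ u i s - E2rhs D v₂ μ₂ u i s| ≤ (Qmax + LQ) * δ + LQ * x := by
  obtain ⟨-, -, hQ, -⟩ := H.bounds_nonneg
  have h := sum_abs_vecMul_sub_le (m₂ := μ₂ s u) hμ₁ (fun j => H.Q_bdd s u _ (v₂ s u) hs hμ₂ j)
    (H.sum_abs_Q_sub_le hs hμ₁ hμ₂ hδ hx)
  have := mul_le_mul_of_nonneg_left hδ hQ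
  unfold E2rhs
  linarith

lemma sum_abs_shiftedE2rhs_sub_le
    (H : Hyps S n T D Lpsi LQ LPsi Llam Psimax psimax Qmax lammax Jmax)
    (hs : memTS n T s u) (hμ₁ : μ₁ s u ∈ simplex S) (hμ₂ : μ₂ s u ∈ simplex S)
    (hδ : ∑ i, |μ₁ s u i - μ₂ s u i| ≤ δ) (hx : ∀ i, |v₁ s u i - v₂ s u i| ≤ x) :
    ∑ i, |shiftedE2rhs D Qmax v₁ μ₁ u i s - shiftedE2rhs D Qmax v₂ μ₂ u i s| ≤
      (Qmax + LQ) * δ + LQ * x := by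
  obtain ⟨-, -, hQ, -⟩ := H.bounds_nonneg
  have hB : ∀ j, ∑ i, |D.Q s u (μ₂ s u) (v₂ s u) j i + if j = i then Qmax else 0| ≤ Qmax := by
    intro j
    simp only [abs_of_nonneg (H.shifted_nonneg hs hμ₂ j _), Finset.sum_add_distrib,
      H.Q_rowsum, Finset.sum_ite_eq, Finset.mem_univ, if_true, zero_add, le_refl]
  have h := sum_abs_vecMul_sub_le (m₂ := μ₂ s u) hμ₁ hB
    (B₁ := fun j i => D.Q s u (μ₁ s u) (v₁ s u) j i + if j = i then Qmax else 0)
    (fun j => by simpa using H.sum_abs_Q_sub_le hs hμ₁ hμ₂ hδ hx j)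
  have := mul_le_mul_of_nonneg_left hδ hQ
  simp only [shiftedE2rhs_eq]
  linarith

end Difference

end Estimates

/-- Relocation of a distribution by a map of the state space. -/
noncomputable def relocate {S : ℕ} (J : Fin S → Fin S) (m : Fin S → ℝ) : Fin S → ℝ :=
  fun j => ∑ i, if J i = j then m i else 0

lemma relocate_mem_simplex {S : ℕ} (J : Fin S → Fin S) {m : Fin S → ℝ} (hm : m ∈ simplex S) :
    relocate J m ∈ simplex S := by
  refine ⟨fun j => Finset.sum_nonneg fun i _ => ?_, ?_⟩
  · split_ifs
    exacts [hm.1 i, le_rfl]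
  · unfold relocate
    rw [Finset.sum_comm]
    simpa using hm.2

lemma sum_abs_relocate_sub_le {S : ℕ} (J : Fin S → Fin S) (m₁ m₂ : Fin S → ℝ) :
    ∑ j, |relocate J m₁ j - relocate J m₂ j| ≤ ∑ i, |m₁ i - m₂ i| := by
  calc ∑ j, |relocate J m₁ j - relocate J m₂ j|
      ≤ ∑ j, ∑ i, if J i = j then |m₁ i - m₂ i| else 0 := by
        refine Finset.sum_le_sum fun j _ => ?_
        unfold relocate
        rw [← Finset.sum_sub_distrib]
        refine (Finset.abs_sum_le_sum_abs _ _).trans (Finset.sum_le_sum fun i _ => ?_)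
        split_ifs <;> simp
    _ = ∑ i, |m₁ i - m₂ i| := by
        rw [Finset.sum_comm]; simp

/-- The distribution at the time of the last shock (or at time `0` if there is none). -/
noncomputable def initDist {S n : ℕ} (D : Model S n) (μ : ℝ → (Fin n → ℝ) → Fin S → ℝ)
    (u : Fin n → ℝ) : Fin S → ℝ :=
  if Zu u = 0 then D.m0 else relocate (D.J (startTime u)) (μ (startTime u) (pop u))

/-- The time weight for distributions after `k` shocks. -/
noncomputable def fwdWeight (Qmax LQ ε : ℝ) (k : ℕ) (t : ℝ) : ℝ :=
  expWeight (Qmax + LQ) (ε * (k + 1)) LQ t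

/-- The a priori bound on the value function. -/
noncomputable def valueBound (n : ℕ) (T Psimax psimax Qmax lammax : ℝ) : ℕ → ℝ → ℝ :=
  bwdWeight (Qmax + lammax) Psimax psimax lammax T n

/-- Pairs with simplex-valued first and `r`-bounded second component on `TS`. -/
structure Feasible (S n : ℕ) (T : ℝ) (r : ℕ → ℝ → ℝ)
    (μ v : ℝ → (Fin n → ℝ) → Fin S → ℝ) : Prop where
  mem_simplex : ∀ t u, memTS n T t u → μ t u ∈ simplex S
  bound : ∀ t u, memTS n T t u → ∀ i, |v t u i| ≤ r (Zu u) t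

/-- Two pairs have weighted distance at most `C` on `TS`. -/
def Close {S n : ℕ} (T : ℝ) (p q : ℕ → ℝ → ℝ) (C : ℝ)
    (μ₁ v₁ μ₂ v₂ : ℝ → (Fin n → ℝ) → Fin S → ℝ) : Prop :=
  ∀ t u, memTS n T t u →
    ∑ i, |μ₁ t u i - μ₂ t u i| ≤ C * p (Zu u) t ∧ ∀ i, |v₁ t u i - v₂ t u i| ≤ C * q (Zu u) t

/-- The conditions on the parameters `ε`, `P` of the weights that make the system contractive. -/
structure SmallWeights (n : ℕ) (T Lpsi LQ LPsi Llam Psimax psimax Qmax lammax K₁ K₂ P ε : ℝ) :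
    Prop where
  K₁_eq : K₁ = K1C n T Lpsi LQ Llam Psimax psimax Qmax lammax
  K₂_eq : K₂ = K2C n T Lpsi LQ Psimax psimax Qmax lammax
  P_eq : P = fwdWeight Qmax LQ ε n T
  pos : 0 < ε
  le_one : geomBound K₂ (ε + LPsi * P + K₁ * P * T) lammax T (n + 1) ≤ 1

section Step

variable {S n : ℕ} {T : ℝ} {D : Model S n}
  {Lpsi LQ LPsi Llam Psimax psimax Qmax lammax : ℝ} {Jmax : ℕ}
  {K₁ K₂ P ε C : ℝ} {μ v μ₁ μ₂ v₁ v₂ : ℝ → (Fin n → ℝ) → Fin S → ℝ} {u : Fin n → ℝ} {t s : ℝ}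

lemma vmaxC_eq (n : ℕ) (T Psimax psimax Qmax lammax : ℝ) :
    vmaxC n T Psimax psimax Qmax lammax =
      geomBound (Qmax + lammax) (Psimax + psimax * T) lammax T (n + 1) := by
  unfold vmaxC geomBound; ring

lemma Hyps.valueBound_le (H : Hyps S n T D Lpsi LQ LPsi Llam Psimax psimax Qmax lammax Jmax)
    (hs : memTS n T s u) :
    valueBound n T Psimax psimax Qmax lammax (Zu u) s ≤ vmaxC n T Psimax psimax Qmax lammax := by
  obtain ⟨h₁, h₂, h₃, h₄⟩ := H.bounds_nonneg
  rw [vmaxC_eq]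
  exact bwdWeight_le_geomBound (by positivity) h₁ h₂ h₄ hs.2.1.1 hs.2.1.2 hs.1.Zu_le

lemma Hyps.vmaxC_nonneg (H : Hyps S n T D Lpsi LQ LPsi Llam Psimax psimax Qmax lammax Jmax) :
    0 ≤ vmaxC n T Psimax psimax Qmax lammax := by
  obtain ⟨h₁, h₂, h₃, h₄⟩ := H.bounds_nonneg
  have := H.hT.le
  rw [vmaxC_eq]
  exact geomBound_nonneg (by positivity) h₄ this _

lemma fwdWeight_le (H : Hyps S n T D Lpsi LQ LPsi Llam Psimax psimax Qmax lammax Jmax)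
    (hε : 0 < ε) (hs : memTS n T s u) :
    fwdWeight Qmax LQ ε (Zu u) s ≤ fwdWeight Qmax LQ ε n T := by
  obtain ⟨-, -, h₃, -⟩ := H.bounds_nonneg
  have h₁ := H.hLQ
  have h₂ := hs.2.1.1
  have h₄ := hs.2.1.2
  have h₅ : (Zu u : ℝ) ≤ n := by exact_mod_cast hs.1.Zu_le
  unfold fwdWeight expWeight
  gcongr

lemma le_fwdWeight (H : Hyps S n T D Lpsi LQ LPsi Llam Psimax psimax Qmax lammax Jmax)
    (hε : 0 < ε) (k : ℕ) (hs : 0 ≤ s) : ε ≤ fwdWeight Qmax LQ ε k s := by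
  obtain ⟨-, -, h₃, -⟩ := H.bounds_nonneg
  have h₁ := H.hLQ
  have h₂ : ε * (k + 1) ≤ fwdWeight Qmax LQ ε k s :=
    le_expWeight (by positivity) (by positivity) h₁.le hs
  have : 0 ≤ ε * (k : ℝ) := by positivity
  linarith

lemma SmallWeights.nonneg
    (W : SmallWeights n T Lpsi LQ LPsi Llam Psimax psimax Qmax lammax K₁ K₂ P ε)
    (H : Hyps S n T D Lpsi LQ LPsi Llam Psimax psimax Qmax lammax Jmax) :
    0 ≤ K₁ ∧ 0 ≤ K₂ ∧ 0 ≤ P := by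
  obtain ⟨-, -, h₃, h₄⟩ := H.bounds_nonneg
  have h₁ := H.vmaxC_nonneg
  have h₂ := H.hLpsi
  have h₅ := H.hLQ
  have h₆ := H.hLlam
  refine ⟨?_, ?_, ?_⟩
  · rw [W.K₁_eq, K1C]; positivity
  · rw [W.K₂_eq, K2C]; positivity
  · rw [W.P_eq]
    exact W.pos.le.trans (le_fwdWeight H W.pos n H.hT.le)

lemma SmallWeights.bwd_bounds
    (W : SmallWeights n T Lpsi LQ LPsi Llam Psimax psimax Qmax lammax K₁ K₂ P ε)
    (H : Hyps S n T D Lpsi LQ LPsi Llam Psimax psimax Qmax lammax Jmax) (hs : memTS n T s u) :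
    ε ≤ bwdWeight K₂ (ε + LPsi * P) (K₁ * P) lammax T n (Zu u) s ∧
      bwdWeight K₂ (ε + LPsi * P) (K₁ * P) lammax T n (Zu u) s ≤ 1 := by
  obtain ⟨-, -, h₃, h₄⟩ := H.bounds_nonneg
  obtain ⟨k₁, k₂, k₃⟩ := W.nonneg H
  have h₁ := W.pos
  have h₂ := H.hLPsi
  constructor
  · refine le_trans ?_ (le_bwdWeight k₂ (by positivity) (by positivity) h₄ H.hT.le hs.2.1.2)
    nlinarith
  · exact (bwdWeight_le_geomBound k₂ (by positivity) (by positivity) h₄ hs.2.1.1 hs.2.1.2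
      hs.1.Zu_le).trans W.le_one

lemma backward_step
    (W : SmallWeights n T Lpsi LQ LPsi Llam Psimax psimax Qmax lammax K₁ K₂ P ε)
    (H : Hyps S n T D Lpsi LQ LPsi Llam Psimax psimax Qmax lammax Jmax)
    (h₁ : Feasible S n T (valueBound n T Psimax psimax Qmax lammax) μ₁ v₁)
    (h₂ : Feasible S n T (valueBound n T Psimax psimax Qmax lammax) μ₂ v₂) (hC : 0 ≤ C)
    (hclose : Close T (fwdWeight Qmax LQ ε)
      (bwdWeight K₂ (ε + LPsi * P) (K₁ * P) lammax T n) C μ₁ v₁ μ₂ v₂)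
    (ht : memTS n T t u) (i : Fin S)
    (hi₁ : IntervalIntegrable (E1rhs D μ₁ v₁ u i) volume t T)
    (hi₂ : IntervalIntegrable (E1rhs D μ₂ v₂ u i) volume t T) :
    |(D.Psi (Zu u) (μ₁ T u) i + ∫ s in t..T, E1rhs D μ₁ v₁ u i s) -
      (D.Psi (Zu u) (μ₂ T u) i + ∫ s in t..T, E1rhs D μ₂ v₂ u i s)| ≤
      C * (bwdWeight K₂ (ε + LPsi * P) (K₁ * P) lammax T n (Zu u) t - ε) := by
  obtain ⟨-, -, hQ, hlam⟩ := H.bounds_nonneg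
  obtain ⟨k₁, k₂, k₃⟩ := W.nonneg H
  have hε := W.pos
  have hLPsi := H.hLPsi
  have hT := H.hT
  set G := geomBound K₂ (ε + LPsi * P + K₁ * P * T) lammax T (n - Zu u) with hG
  have hG₀ : 0 ≤ G := geomBound_nonneg (by positivity) hlam hT.le _
  set w := bwdWeight K₂ (ε + LPsi * P) (K₁ * P) lammax T n (Zu u) with hw
  have hwc : Continuous w := continuous_bwdWeight _ _ _ _ _ _ _
  have hμ : ∀ s, memTS n T s u → ∑ i, |μ₁ s u i - μ₂ s u i| ≤ C * P := fun s hs =>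
    (hclose s u hs).1.trans (mul_le_mul_of_nonneg_left
      (W.P_eq ▸ fwdWeight_le H hε hs) hC)
  have hdiff : ∀ s ∈ Set.Icc t T, |E1rhs D μ₁ v₁ u i s - E1rhs D μ₂ v₂ u i s| ≤
      C * (K₂ * w s + (K₁ * P + lammax * G)) := by
    intro s hs
    have hs' := ht.of_le hs.1 hs.2
    have h := abs_E1rhs_sub_le H hs' (h₁.mem_simplex s u hs') (h₂.mem_simplex s u hs')
      (V := vmaxC n T Psimax psimax Qmax lammax) (y := C * G)
      (fun i => (h₁.bound s u hs' i).trans (H.valueBound_le hs'))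
      (fun hZ i => (h₁.bound s _ (hs'.push hZ).1 i).trans (H.valueBound_le (hs'.push hZ).1))
      (hμ s hs') (hclose s u hs').2
      (fun hZ i => ((hclose s _ (hs'.push hZ).1).2 i).trans (mul_le_mul_of_nonneg_left (by
        rw [(hs'.push hZ).2]
        refine (bwdWeight_le_geomBound_sub k₂ (by positivity) (by positivity) hlam hs'.2.1.1
          hs'.2.1.2 hZ).trans_eq ?_
        rw [hG]; congr 1; omega) hC)) (by positivity) i
    have e₁ := W.K₁_eq
    have e₂ := W.K₂_eq
    unfold K1C at e₁
    unfold K2C at e₂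
    rw [← e₁, ← e₂] at h
    linarith
  have hdiff_int := abs_integral_le_of_le ht.2.1.2 (hi₁.sub hi₂)
    (Continuous.intervalIntegrable (by fun_prop) _ _) hdiff
  rw [intervalIntegral.integral_sub hi₁ hi₂, intervalIntegral.integral_const_mul] at hdiff_int
  have hb := bwdWeight_backward (n := n) (k := Zu u) k₂
    (show 0 ≤ ε + LPsi * P by positivity) (show 0 ≤ K₁ * P by positivity) hlam hT.le ht.2.1.2
  rw [← hw, ← hG] at hb
  have hTS := memTS_end hT.le ht.1
  have hPsi : |D.Psi (Zu u) (μ₁ T u) i - D.Psi (Zu u) (μ₂ T u) i| ≤ LPsi * (C * P) := by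
    have h := H.Psi_lip (Zu u) ht.1.Zu_le _ (h₁.mem_simplex T u hTS) _ (h₂.mem_simplex T u hTS)
    have h' := (norm_le_pi_norm (D.Psi (Zu u) (μ₁ T u) - D.Psi (Zu u) (μ₂ T u)) i).trans h
    exact h'.trans (mul_le_mul_of_nonneg_left
      ((norm_sub_le_sum_abs _ _).trans (hμ T hTS)) hLPsi.le)
  rw [add_sub_add_comm]
  refine (abs_add_le _ _).trans ?_
  have hb' := mul_le_mul_of_nonneg_left hb hC
  linarith

lemma forward_step (H : Hyps S n T D Lpsi LQ LPsi Llam Psimax psimax Qmax lammax Jmax)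
    (hC : 0 ≤ C) {k : ℕ} {a s₀ : ℝ} (ha₀ : 0 ≤ a) (ha₁ : a ≤ 1) (hs₀ : 0 ≤ s₀) (hst : s₀ ≤ t)
    {x₁ x₂ : Fin S → ℝ} {f₁ f₂ : Fin S → ℝ → ℝ}
    (hx : ∑ i, |x₁ i - x₂ i| ≤ C * (fwdWeight Qmax LQ ε k s₀ - ε))
    (hi₁ : ∀ i, IntervalIntegrable (f₁ i) volume s₀ t)
    (hi₂ : ∀ i, IntervalIntegrable (f₂ i) volume s₀ t)
    (hf : ∀ s ∈ Set.Icc s₀ t, ∑ i, |f₁ i s - f₂ i s| ≤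
      C * ((Qmax + LQ) * fwdWeight Qmax LQ ε k s + LQ)) :
    ∑ i, |(a * x₁ i + ∫ s in s₀..t, f₁ i s) - (a * x₂ i + ∫ s in s₀..t, f₂ i s)| ≤
      C * (fwdWeight Qmax LQ ε k t - ε) := by
  obtain ⟨-, -, hQ, -⟩ := H.bounds_nonneg
  have hLQ := H.hLQ
  have hc : Continuous (fwdWeight Qmax LQ ε k) := continuous_expWeight _ _ _
  have h₁ := sum_abs_integral_le hst (fun i => (hi₁ i).sub (hi₂ i))
    (Continuous.intervalIntegrable (by fun_prop) _ _) hf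
  rw [intervalIntegral.integral_const_mul] at h₁
  have h₂ : fwdWeight Qmax LQ ε k s₀ + ∫ s in s₀..t, ((Qmax + LQ) * fwdWeight Qmax LQ ε k s + LQ) ≤
      fwdWeight Qmax LQ ε k t := expWeight_add_integral_le (by positivity) hLQ.le hs₀ hst
  have h₃ : ∑ i, |(a * x₁ i + ∫ s in s₀..t, f₁ i s) - (a * x₂ i + ∫ s in s₀..t, f₂ i s)| ≤
      ∑ i, (|x₁ i - x₂ i| + |∫ s in s₀..t, (f₁ i s - f₂ i s)|) := by
    refine Finset.sum_le_sum fun i _ => ?_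
    rw [intervalIntegral.integral_sub (hi₁ i) (hi₂ i), add_sub_add_comm, ← mul_sub]
    refine (abs_add_le _ _).trans (add_le_add_left ?_ _)
    rw [abs_mul, abs_of_nonneg ha₀]
    exact mul_le_of_le_one_left (abs_nonneg _) ha₁
  rw [Finset.sum_add_distrib] at h₃
  have h₄ := mul_le_mul_of_nonneg_left h₂ hC
  linarith

lemma sum_abs_initDist_sub_le
    (H : Hyps S n T D Lpsi LQ LPsi Llam Psimax psimax Qmax lammax Jmax) (hε : 0 < ε)
    (hC : 0 ≤ C) {q : ℕ → ℝ → ℝ} (hclose : Close T (fwdWeight Qmax LQ ε) q C μ₁ v₁ μ₂ v₂)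
    (hu : memU n T u) :
    ∑ i, |initDist D μ₁ u i - initDist D μ₂ u i| ≤
      C * (fwdWeight Qmax LQ ε (Zu u) (startTime u) - ε) := by
  have hs := hu.startTime_mem H.hT.le
  rcases Nat.eq_zero_or_pos (Zu u) with hZ | hZ
  · have := le_fwdWeight H hε (Zu u) hs.1
    simp only [initDist, if_pos hZ, sub_self, abs_zero, Finset.sum_const_zero]
    exact mul_nonneg hC (by linarith)
  · obtain ⟨hp, hp'⟩ := hu.pop H.hT.le hZ
    simp only [initDist, if_neg hZ.ne']
    refine (sum_abs_relocate_sub_le _ _ _).trans ((hclose _ _ hp).1.trans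
      (mul_le_mul_of_nonneg_left ?_ hC))
    obtain ⟨-, -, hQ, -⟩ := H.bounds_nonneg
    have hLQ := H.hLQ
    have h₁ : 1 ≤ Real.exp ((Qmax + LQ) * startTime u) :=
      Real.one_le_exp (mul_nonneg (by positivity) hs.1)
    rw [hp', fwdWeight, fwdWeight, expWeight, expWeight, Nat.cast_sub hZ, Nat.cast_one]
    nlinarith

lemma mul_sub_le_contraction {w : ℝ} (hε : 0 < ε) (hP : 0 ≤ P) (hw : w ≤ P + 1) (hC : 0 ≤ C) :
    C * (w - ε) ≤ (1 - ε / (P + 1)) * C * w := by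
  have h : ε / (P + 1) * w ≤ ε := by
    rw [div_mul_eq_mul_div, div_le_iff₀ (by positivity)]
    exact mul_le_mul_of_nonneg_left hw hε.le
  nlinarith [mul_le_mul_of_nonneg_left h hC]

lemma close_of_steps
    (W : SmallWeights n T Lpsi LQ LPsi Llam Psimax psimax Qmax lammax K₁ K₂ P ε)
    (H : Hyps S n T D Lpsi LQ LPsi Llam Psimax psimax Qmax lammax Jmax) (hC : 0 ≤ C)
    (h : ∀ t u, memTS n T t u →
      ∑ i, |μ₁ t u i - μ₂ t u i| ≤ C * (fwdWeight Qmax LQ ε (Zu u) t - ε) ∧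
      ∀ i, |v₁ t u i - v₂ t u i| ≤
        C * (bwdWeight K₂ (ε + LPsi * P) (K₁ * P) lammax T n (Zu u) t - ε)) :
    Close T (fwdWeight Qmax LQ ε) (bwdWeight K₂ (ε + LPsi * P) (K₁ * P) lammax T n)
      ((1 - ε / (P + 1)) * C) μ₁ v₁ μ₂ v₂ := by
  intro t u ht
  obtain ⟨k₁, k₂, k₃⟩ := W.nonneg H
  have hp : fwdWeight Qmax LQ ε (Zu u) t ≤ P := W.P_eq ▸ fwdWeight_le H W.pos ht
  have hq := (W.bwd_bounds H ht).2
  exact ⟨(h t u ht).1.trans (mul_sub_le_contraction W.pos k₃ (by linarith) hC),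
    fun i => ((h t u ht).2 i).trans (mul_sub_le_contraction W.pos k₃ (by linarith) hC)⟩

lemma SolForward.start_eq (hF : SolForward S n T D v μ) (hu : memU n T u) (i : Fin S) :
    μ (startTime u) u i = initDist D μ u i := by
  rcases Nat.eq_zero_or_pos (Zu u) with hZ | hZ
  · rw [initDist, if_pos hZ, startTime, if_pos hZ, hu.eq_neg_one hZ]
    exact hF.1 i
  · rw [initDist, if_neg hZ.ne', startTime_of_pos hZ]
    exact hF.2.1 u hu hZ i

/-- A priori bound for solutions of the backward equation. -/
lemma SolBackward.feasible
    (H : Hyps S n T D Lpsi LQ LPsi Llam Psimax psimax Qmax lammax Jmax)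
    (hμ : ∀ t u, memTS n T t u → μ t u ∈ simplex S) (hB : SolBackward S n T D μ v) :
    Feasible S n T (valueBound n T Psimax psimax Qmax lammax) μ v := by
  obtain ⟨hPsi, hpsi, hQ, hlam⟩ := H.bounds_nonneg
  have hT := H.hT.le
  refine ⟨hμ, ?_⟩
  suffices h : ∀ j : ℕ, ∀ u, memU n T u → Zu u + j = n → ∀ t, memTS n T t u → ∀ i,
      |v t u i| ≤ valueBound n T Psimax psimax Qmax lammax (Zu u) t from
    fun t u ht => h (n - Zu u) u ht.1 (by have := ht.1.Zu_le; omega) t ht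
  intro j
  induction j with
  | zero | succ j ih =>
    intro u hu hj
    set G := geomBound (Qmax + lammax) (Psimax + psimax * T) lammax T (n - Zu u) with hG
    have hG₀ : 0 ≤ G := geomBound_nonneg (by positivity) hlam hT _
    have hpush : ∀ s, memTS n T s u → Zu u < n → ∀ i, |v s (push u s) i| ≤ G := by
      intro s hs hZ i
      first
      | omega
      | obtain ⟨h₁, h₂⟩ := hs.push hZ
        refine (ih _ h₁.1 (by omega) s h₁ i).trans ?_
        rw [h₂]
        refine (bwdWeight_le_geomBound_sub (by positivity) hPsi hpsi hlam hs.2.1.1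
          hs.2.1.2 hZ).trans_eq ?_
        rw [hG]; congr 1; omega
    have hTS := memTS_end hT hu
    have hs₀ := memTS_startTime hT hu
    have hmem : ∀ t ∈ Set.Icc (startTime u) T, memTS n T t u := fun t ht => hs₀.of_le ht.1 ht.2
    have hΨ : ∀ i, |D.Psi (Zu u) (μ T u) i| ≤ Psimax := fun i =>
      H.Psi_bdd _ hu.Zu_le _ (hμ T u hTS) i
    have key := le_expWeight_of_majorant (a := Qmax + lammax) (b₀ := Psimax)
      (b := psimax + lammax * G) (T := T) (s₀ := startTime u)
      (M := Psimax + ∑ i, ∫ s in startTime u..T, |E1rhs D μ v u i s|)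
      (by positivity) (by positivity) hPsi (fun t => ‖v t u‖) ?_ ?_
    · intro t ht i
      exact (norm_le_pi_norm (v t u) i).trans (key t ((memTS_iff hT hu).1 ht))
    · intro t ht
      have hpos : ∀ i, 0 ≤ ∫ s in startTime u..T, |E1rhs D μ v u i s| := fun i =>
        intervalIntegral.integral_nonneg hs₀.2.1.2 fun _ _ => abs_nonneg _
      refine (pi_norm_le_iff_of_nonneg
        (add_nonneg hPsi (Finset.sum_nonneg fun i _ => hpos i))).2 fun i => ?_
      rw [((hB u hu).2 t (hmem t ht) i).2]
      refine (abs_add_le _ _).trans (add_le_add (hΨ i) ?_)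
      refine (intervalIntegral.abs_integral_le_integral_abs ht.2).trans ?_
      refine le_trans ?_ (Finset.single_le_sum (fun i _ => hpos i) (Finset.mem_univ i))
      exact intervalIntegral.integral_mono_interval ht.1 ht.2 le_rfl
        (Filter.Eventually.of_forall fun _ => abs_nonneg _)
        ((hB u hu).2 _ hs₀ i).1.abs
    · intro φ hφ hle t ht
      have hφ₀ : 0 ≤ φ t := (norm_nonneg _).trans (hle t ht)
      have hbd : ∀ i, |v t u i| ≤ Psimax +
          ∫ s in t..T, ((Qmax + lammax) * φ s + (psimax + lammax * G)) := by
        intro i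
        rw [((hB u hu).2 t (hmem t ht) i).2]
        refine (abs_add_le _ _).trans (add_le_add (hΨ i) ?_)
        refine abs_integral_le_of_le ht.2 ((hB u hu).2 t (hmem t ht) i).1
          (Continuous.intervalIntegrable (by fun_prop) _ _) fun s hs => ?_
        have hs' : s ∈ Set.Icc (startTime u) T := ⟨ht.1.trans hs.1, hs.2⟩
        have := abs_E1rhs_le H (hmem s hs') (hμ s u (hmem s hs'))
          (fun i => (norm_le_pi_norm (v s u) i).trans (hle s hs')) (hpush s (hmem s hs')) hG₀ i
        linarith
      obtain ⟨i₀⟩ := H.nonempty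
      exact (pi_norm_le_iff_of_nonneg ((abs_nonneg _).trans (hbd i₀))).2 hbd

end Step

section Distance

variable {S n : ℕ} {T : ℝ} {D : Model S n}
  {Lpsi LQ LPsi Llam Psimax psimax Qmax lammax : ℝ} {Jmax : ℕ}
  {K₁ K₂ P ε C : ℝ} {μ v μ₁ μ₂ v₁ v₂ : ℝ → (Fin n → ℝ) → Fin S → ℝ} {u : Fin n → ℝ} {t s : ℝ}

lemma SmallWeights.contraction_mem
    (W : SmallWeights n T Lpsi LQ LPsi Llam Psimax psimax Qmax lammax K₁ K₂ P ε)
    (H : Hyps S n T D Lpsi LQ LPsi Llam Psimax psimax Qmax lammax Jmax) :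
    0 ≤ 1 - ε / (P + 1) ∧ 1 - ε / (P + 1) < 1 := by
  have hε := W.pos
  have hP : ε ≤ P := W.P_eq ▸ le_fwdWeight H W.pos n H.hT.le
  have h₁ : ε / (P + 1) ≤ 1 := (div_le_one (by linarith)).2 (by linarith)
  have h₂ : 0 < ε / (P + 1) := div_pos hε (by linarith)
  constructor <;> linarith

lemma Close.abs_sub_le
    (W : SmallWeights n T Lpsi LQ LPsi Llam Psimax psimax Qmax lammax K₁ K₂ P ε)
    (H : Hyps S n T D Lpsi LQ LPsi Llam Psimax psimax Qmax lammax Jmax) (hC : 0 ≤ C)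
    (h : Close T (fwdWeight Qmax LQ ε) (bwdWeight K₂ (ε + LPsi * P) (K₁ * P) lammax T n)
      C μ₁ v₁ μ₂ v₂) (ht : memTS n T t u) (i : Fin S) :
    |μ₁ t u i - μ₂ t u i| ≤ C * (P + 1) ∧ |v₁ t u i - v₂ t u i| ≤ C * (P + 1) := by
  obtain ⟨-, -, k₃⟩ := W.nonneg H
  have hp : fwdWeight Qmax LQ ε (Zu u) t ≤ P := W.P_eq ▸ fwdWeight_le H W.pos ht
  have hq := (W.bwd_bounds H ht).2
  exact ⟨(Finset.single_le_sum (f := fun i => |μ₁ t u i - μ₂ t u i|)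
      (fun _ _ => abs_nonneg _) (Finset.mem_univ i)).trans ((h t u ht).1.trans
        (mul_le_mul_of_nonneg_left (by linarith) hC)),
    ((h t u ht).2 i).trans (mul_le_mul_of_nonneg_left (by linarith) hC)⟩

lemma close_of_abs_sub_le
    (W : SmallWeights n T Lpsi LQ LPsi Llam Psimax psimax Qmax lammax K₁ K₂ P ε)
    (H : Hyps S n T D Lpsi LQ LPsi Llam Psimax psimax Qmax lammax Jmax)
    (h : ∀ t u, memTS n T t u → ∀ i,
      |μ₁ t u i - μ₂ t u i| ≤ C ∧ |v₁ t u i - v₂ t u i| ≤ C) :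
    Close T (fwdWeight Qmax LQ ε) (bwdWeight K₂ (ε + LPsi * P) (K₁ * P) lammax T n)
      (S * C / ε) μ₁ v₁ μ₂ v₂ := by
  intro t u ht
  have hε := W.pos
  obtain ⟨i₀⟩ := H.nonempty
  have hC : 0 ≤ C := (abs_nonneg _).trans (h t u ht i₀).1
  have hS : (1 : ℝ) ≤ S := by exact_mod_cast H.hS
  have key : ∀ w, ε ≤ w → S * C ≤ S * C / ε * w := fun w hw => by
    rw [div_mul_eq_mul_div, le_div_iff₀ hε]
    exact mul_le_mul_of_nonneg_left hw (by positivity)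
  constructor
  · refine le_trans ?_ (key _ (le_fwdWeight H hε _ ht.2.1.1))
    calc ∑ i, |μ₁ t u i - μ₂ t u i| ≤ ∑ _i : Fin S, C :=
          Finset.sum_le_sum fun i _ => (h t u ht i).1
      _ = S * C := by simp
  · exact fun i => ((h t u ht i).2.trans (le_mul_of_one_le_left hC hS)).trans
      (key _ (W.bwd_bounds H ht).1)

lemma abs_sub_le_one_of_mem_simplex {m₁ m₂ : Fin S → ℝ} (h₁ : m₁ ∈ simplex S)
    (h₂ : m₂ ∈ simplex S) (i : Fin S) : |m₁ i - m₂ i| ≤ 1 := by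
  have e₁ := Finset.single_le_sum (fun i _ => h₁.1 i) (Finset.mem_univ i)
  have e₂ := Finset.single_le_sum (fun i _ => h₂.1 i) (Finset.mem_univ i)
  rw [h₁.2] at e₁
  rw [h₂.2] at e₂
  have := h₁.1 i
  have := h₂.1 i
  rw [abs_le]
  constructor <;> linarith

lemma exists_close_of_feasible
    (W : SmallWeights n T Lpsi LQ LPsi Llam Psimax psimax Qmax lammax K₁ K₂ P ε)
    (H : Hyps S n T D Lpsi LQ LPsi Llam Psimax psimax Qmax lammax Jmax)
    (h₁ : Feasible S n T (valueBound n T Psimax psimax Qmax lammax) μ₁ v₁)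
    (h₂ : Feasible S n T (valueBound n T Psimax psimax Qmax lammax) μ₂ v₂) :
    ∃ C, 0 ≤ C ∧ Close T (fwdWeight Qmax LQ ε)
      (bwdWeight K₂ (ε + LPsi * P) (K₁ * P) lammax T n) C μ₁ v₁ μ₂ v₂ := by
  have hV := H.vmaxC_nonneg
  have hε := W.pos
  refine ⟨S * (1 + 2 * vmaxC n T Psimax psimax Qmax lammax) / ε, by positivity,
    close_of_abs_sub_le W H fun t u ht i => ⟨?_, ?_⟩⟩
  · have := abs_sub_le_one_of_mem_simplex (h₁.mem_simplex t u ht) (h₂.mem_simplex t u ht) i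
    linarith
  · have e₁ := (h₁.bound t u ht i).trans (H.valueBound_le ht)
    have e₂ := (h₂.bound t u ht i).trans (H.valueBound_le ht)
    have := abs_sub (v₁ t u i) (v₂ t u i)
    linarith

lemma close_of_solutions
    (W : SmallWeights n T Lpsi LQ LPsi Llam Psimax psimax Qmax lammax K₁ K₂ P ε)
    (H : Hyps S n T D Lpsi LQ LPsi Llam Psimax psimax Qmax lammax Jmax) (hC : 0 ≤ C)
    (h₁ : Feasible S n T (valueBound n T Psimax psimax Qmax lammax) μ₁ v₁)
    (h₂ : Feasible S n T (valueBound n T Psimax psimax Qmax lammax) μ₂ v₂)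
    (hB₁ : SolBackward S n T D μ₁ v₁) (hF₁ : SolForward S n T D v₁ μ₁)
    (hB₂ : SolBackward S n T D μ₂ v₂) (hF₂ : SolForward S n T D v₂ μ₂)
    (h : Close T (fwdWeight Qmax LQ ε) (bwdWeight K₂ (ε + LPsi * P) (K₁ * P) lammax T n)
      C μ₁ v₁ μ₂ v₂) :
    Close T (fwdWeight Qmax LQ ε) (bwdWeight K₂ (ε + LPsi * P) (K₁ * P) lammax T n)
      ((1 - ε / (P + 1)) * C) μ₁ v₁ μ₂ v₂ := by
  refine close_of_steps W H hC fun t u ht => ⟨?_, fun i => ?_⟩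
  · have hs₀ := ht.1.startTime_mem H.hT.le
    have hst := ((memTS_iff H.hT.le ht.1).1 ht).1
    have hf : ∀ s ∈ Set.Icc (startTime u) t,
        ∑ i, |E2rhs D v₁ μ₁ u i s - E2rhs D v₂ μ₂ u i s| ≤
          C * ((Qmax + LQ) * fwdWeight Qmax LQ ε (Zu u) s + LQ) := by
      intro s hs
      have hs' : memTS n T s u := (memTS_iff H.hT.le ht.1).2 ⟨hs.1, hs.2.trans ht.2.1.2⟩
      have := sum_abs_E2rhs_sub_le H hs' (h₁.mem_simplex s u hs') (h₂.mem_simplex s u hs')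
        (h s u hs').1 (x := C) fun i => ((h s u hs').2 i).trans
          (mul_le_of_le_one_right hC (W.bwd_bounds H hs').2)
      linarith
    have := forward_step H hC zero_le_one le_rfl hs₀.1 hst
      (sum_abs_initDist_sub_le H W.pos hC h ht.1) (fun i => (hF₁.2.2 u ht.1 t ht i).1)
      (fun i => (hF₂.2.2 u ht.1 t ht i).1) hf
    simp only [one_mul, ← hF₁.start_eq ht.1, ← hF₂.start_eq ht.1,
      ← (hF₁.2.2 u ht.1 t ht _).2, ← (hF₂.2.2 u ht.1 t ht _).2] at this
    exact this
  · obtain ⟨i₁, e₁⟩ := (hB₁ u ht.1).2 t ht i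
    obtain ⟨i₂, e₂⟩ := (hB₂ u ht.1).2 t ht i
    rw [e₁, e₂]
    exact backward_step W H h₁ h₂ hC h ht i i₁ i₂

lemma eq_of_solutions
    (W : SmallWeights n T Lpsi LQ LPsi Llam Psimax psimax Qmax lammax K₁ K₂ P ε)
    (H : Hyps S n T D Lpsi LQ LPsi Llam Psimax psimax Qmax lammax Jmax)
    (hμ₁ : ∀ t u, memTS n T t u → μ₁ t u ∈ simplex S)
    (hμ₂ : ∀ t u, memTS n T t u → μ₂ t u ∈ simplex S)
    (hB₁ : SolBackward S n T D μ₁ v₁) (hF₁ : SolForward S n T D v₁ μ₁)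
    (hB₂ : SolBackward S n T D μ₂ v₂) (hF₂ : SolForward S n T D v₂ μ₂)
    (ht : memTS n T t u) : μ₁ t u = μ₂ t u ∧ v₁ t u = v₂ t u := by
  have f₁ := hB₁.feasible H hμ₁
  have f₂ := hB₂.feasible H hμ₂
  obtain ⟨C, hC, h⟩ := exists_close_of_feasible W H f₁ f₂
  obtain ⟨θ₀, θ₁⟩ := W.contraction_mem H
  have hm : ∀ m : ℕ, Close T (fwdWeight Qmax LQ ε)
      (bwdWeight K₂ (ε + LPsi * P) (K₁ * P) lammax T n) ((1 - ε / (P + 1)) ^ m * C)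
      μ₁ v₁ μ₂ v₂ := by
    intro m
    induction m with
    | zero => simpa using h
    | succ m ih =>
      have := close_of_solutions W H (by positivity) f₁ f₂ hB₁ hF₁ hB₂ hF₂ ih
      rwa [← mul_assoc, ← pow_succ'] at this
  have hlim : Filter.Tendsto (fun m : ℕ => (1 - ε / (P + 1)) ^ m * C * (P + 1)) Filter.atTop
      (nhds 0) := by
    simpa using ((tendsto_pow_atTop_nhds_zero_of_lt_one θ₀ θ₁).mul_const C).mul_const (P + 1)
  have hzero : ∀ x : ℝ, (∀ m : ℕ, |x| ≤ (1 - ε / (P + 1)) ^ m * C * (P + 1)) → x = 0 :=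
    fun x hx => abs_nonpos_iff.1 (ge_of_tendsto' hlim hx)
  constructor <;> ext i
  · exact sub_eq_zero.1 (hzero _ fun m => ((hm m).abs_sub_le W H (by positivity) ht i).1)
  · exact sub_eq_zero.1 (hzero _ fun m => ((hm m).abs_sub_le W H (by positivity) ht i).2)

end Distance

section Picard

variable {S n : ℕ} {T : ℝ} {D : Model S n}
  {Lpsi LQ LPsi Llam Psimax psimax Qmax lammax : ℝ} {Jmax : ℕ}
  {K₁ K₂ P ε C : ℝ} {μ v μ₁ μ₂ v₁ v₂ : ℝ → (Fin n → ℝ) → Fin S → ℝ} {u : Fin n → ℝ} {t s : ℝ}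

/-- Feasible pairs that are jointly measurable in time and shock history. -/
structure Admissible (S n : ℕ) (T : ℝ) (r : ℕ → ℝ → ℝ)
    (μ v : ℝ → (Fin n → ℝ) → Fin S → ℝ) : Prop extends Feasible S n T r μ v where
  measurable_fst : Measurable fun p : ℝ × (Fin n → ℝ) => μ p.1 p.2
  measurable_snd : Measurable fun p : ℝ × (Fin n → ℝ) => v p.1 p.2

/-- The update of the value function in the Picard iteration. -/
noncomputable def picardValue (T : ℝ) (D : Model S n) (μ v : ℝ → (Fin n → ℝ) → Fin S → ℝ) :
    ℝ → (Fin n → ℝ) → Fin S → ℝ :=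
  fun t u i => D.Psi (Zu u) (μ T u) i + ∫ s in t..T, E1rhs D μ v u i s

/-- The update of the distribution flow in the Picard iteration. It is the
variation-of-constants form of the forward equation, so that the simplex is preserved. -/
noncomputable def picardFlow (Qmax : ℝ) (D : Model S n) (μ v : ℝ → (Fin n → ℝ) → Fin S → ℝ) :
    ℝ → (Fin n → ℝ) → Fin S → ℝ :=
  fun t u i => Real.exp (-(Qmax * (t - startTime u))) * initDist D μ u i +
    ∫ s in startTime u..t, Real.exp (-(Qmax * (t - s))) * shiftedE2rhs D Qmax v μ u i s

lemma measurable_apply_of_finite {α : Type*} [MeasurableSpace α] {w : α → Fin S → ℝ}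
    {j : α → Fin S} (hw : Measurable w) (hj : Measurable j) : Measurable fun x => w x (j x) :=
  (measurable_from_prod_countable_left (f := fun p : (Fin S → ℝ) × Fin S => p.1 p.2)
    fun j => measurable_pi_apply j).comp (hw.prodMk hj)

lemma measurable_E1rhs (H : Hyps S n T D Lpsi LQ LPsi Llam Psimax psimax Qmax lammax Jmax)
    (hμ : Measurable fun p : ℝ × (Fin n → ℝ) => μ p.1 p.2)
    (hv : Measurable fun p : ℝ × (Fin n → ℝ) => v p.1 p.2) (i : Fin S) :
    Measurable fun p : (Fin n → ℝ) × ℝ => E1rhs D μ v p.1 i p.2 := by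
  have hμ' : Measurable fun p : (Fin n → ℝ) × ℝ => μ p.2 p.1 := hμ.comp measurable_swap
  have hv' : Measurable fun p : (Fin n → ℝ) × ℝ => v p.2 p.1 := hv.comp measurable_swap
  have hd : Measurable fun p : (Fin n → ℝ) × ℝ => (p.2, p.1, μ p.2 p.1, v p.2 p.1) :=
    measurable_snd.prodMk (measurable_fst.prodMk (hμ'.prodMk hv'))
  have hpsi : Measurable fun p : (Fin n → ℝ) × ℝ => D.psi p.2 p.1 (μ p.2 p.1) (v p.2 p.1) i :=
    (measurable_pi_apply i).comp (H.psi_meas.comp hd)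
  have hQ : ∀ j, Measurable fun p : (Fin n → ℝ) × ℝ =>
      D.Q p.2 p.1 (μ p.2 p.1) (v p.2 p.1) i j := fun j =>
    (measurable_pi_apply j).comp ((measurable_pi_apply i).comp (H.Q_meas.comp hd))
  have hlam : Measurable fun p : (Fin n → ℝ) × ℝ => D.lam (Zu p.1 + 1) p.2 (μ p.2 p.1) :=
    (measurable_from_prod_countable_left
      (f := fun p : (ℝ × (Fin S → ℝ)) × ℕ => D.lam (p.2 + 1) p.1.1 p.1.2)
      fun k => H.lam_meas (k + 1)).comp
      ((measurable_snd.prodMk hμ').prodMk (measurable_Zu.comp measurable_fst))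
  have hpush : Measurable fun p : (Fin n → ℝ) × ℝ => v p.2 (push p.1 p.2) :=
    hv.comp (measurable_snd.prodMk (measurable_push.comp measurable_swap))
  have hJ : Measurable fun p : (Fin n → ℝ) × ℝ => D.J p.2 i :=
    (measurable_pi_apply i).comp (H.J_meas.comp measurable_snd)
  have hvJ := measurable_apply_of_finite hpush hJ
  have hvi : ∀ j, Measurable fun p : (Fin n → ℝ) × ℝ => v p.2 p.1 j := fun j =>
    (measurable_pi_apply j).comp hv'
  unfold E1rhs
  refine (hpsi.add (Finset.measurable_sum _ fun j _ => (hQ j).mul (hvi j))).add ?_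
  refine Measurable.ite ?_ (hlam.mul (hvJ.sub (hvi i))) measurable_const
  exact measurableSet_lt (measurable_Zu.comp measurable_fst) measurable_const

lemma measurable_shiftedE2rhs
    (H : Hyps S n T D Lpsi LQ LPsi Llam Psimax psimax Qmax lammax Jmax)
    (hμ : Measurable fun p : ℝ × (Fin n → ℝ) => μ p.1 p.2)
    (hv : Measurable fun p : ℝ × (Fin n → ℝ) => v p.1 p.2) (i : Fin S) :
    Measurable fun p : (Fin n → ℝ) × ℝ => shiftedE2rhs D Qmax v μ p.1 i p.2 := by
  have hμ' : Measurable fun p : (Fin n → ℝ) × ℝ => μ p.2 p.1 := hμ.comp measurable_swap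
  have hv' : Measurable fun p : (Fin n → ℝ) × ℝ => v p.2 p.1 := hv.comp measurable_swap
  have hd : Measurable fun p : (Fin n → ℝ) × ℝ => (p.2, p.1, μ p.2 p.1, v p.2 p.1) :=
    measurable_snd.prodMk (measurable_fst.prodMk (hμ'.prodMk hv'))
  have hQ : ∀ j, Measurable fun p : (Fin n → ℝ) × ℝ =>
      D.Q p.2 p.1 (μ p.2 p.1) (v p.2 p.1) j i := fun j =>
    (measurable_pi_apply i).comp ((measurable_pi_apply j).comp (H.Q_meas.comp hd))
  have hμi : ∀ j, Measurable fun p : (Fin n → ℝ) × ℝ => μ p.2 p.1 j := fun j =>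
    (measurable_pi_apply j).comp hμ'
  unfold shiftedE2rhs E2rhs
  exact (Finset.measurable_sum _ fun j _ => (hμi j).mul (hQ j)).add ((hμi i).const_mul _)

lemma measurable_initDist
    (H : Hyps S n T D Lpsi LQ LPsi Llam Psimax psimax Qmax lammax Jmax)
    (hμ : Measurable fun p : ℝ × (Fin n → ℝ) => μ p.1 p.2) (i : Fin S) :
    Measurable fun u => initDist D μ u i := by
  have hs : Measurable fun u : Fin n → ℝ => μ (startTime u) (pop u) :=
    hμ.comp (measurable_startTime.prodMk measurable_pop)
  have hJ : ∀ j, Measurable fun u : Fin n → ℝ => D.J (startTime u) j := fun j =>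
    (measurable_pi_apply j).comp (H.J_meas.comp measurable_startTime)
  have e : (fun u => initDist D μ u i) = fun u => if Zu u = 0 then D.m0 i else
      ∑ j, if D.J (startTime u) j = i then μ (startTime u) (pop u) j else 0 := by
    ext u
    unfold initDist relocate
    split_ifs <;> rfl
  rw [e]
  refine Measurable.ite (measurableSet_eq_fun measurable_Zu measurable_const) measurable_const
    (Finset.measurable_sum _ fun j _ => Measurable.ite
      (measurableSet_eq_fun (hJ j) measurable_const) ((measurable_pi_apply j).comp hs)
      measurable_const)

lemma measurable_picardValue
    (H : Hyps S n T D Lpsi LQ LPsi Llam Psimax psimax Qmax lammax Jmax)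
    (hμ : Measurable fun p : ℝ × (Fin n → ℝ) => μ p.1 p.2)
    (hv : Measurable fun p : ℝ × (Fin n → ℝ) => v p.1 p.2) :
    Measurable fun p : ℝ × (Fin n → ℝ) => picardValue T D μ v p.1 p.2 := by
  refine measurable_pi_lambda _ fun i => Measurable.add ?_ ?_
  · have : Measurable fun p : (Fin S → ℝ) × ℕ => D.Psi p.2 p.1 i :=
      measurable_from_prod_countable_left fun k => (measurable_pi_apply i).comp (H.Psi_meas k)
    exact this.comp ((hμ.comp (measurable_const.prodMk measurable_snd)).prodMk
      (measurable_Zu.comp measurable_snd))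
  · exact measurable_intervalIntegral_param
      (f := fun (p : ℝ × (Fin n → ℝ)) s => E1rhs D μ v p.2 i s)
      ((measurable_E1rhs H hμ hv i).comp
        ((measurable_snd.comp measurable_fst).prodMk measurable_snd))
      measurable_fst measurable_const

lemma measurable_picardFlow
    (H : Hyps S n T D Lpsi LQ LPsi Llam Psimax psimax Qmax lammax Jmax)
    (hμ : Measurable fun p : ℝ × (Fin n → ℝ) => μ p.1 p.2)
    (hv : Measurable fun p : ℝ × (Fin n → ℝ) => v p.1 p.2) :
    Measurable fun p : ℝ × (Fin n → ℝ) => picardFlow Qmax D μ v p.1 p.2 := by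
  refine measurable_pi_lambda _ fun i => Measurable.add (Measurable.mul ?_ ?_) ?_
  · exact (((measurable_fst.sub (measurable_startTime.comp measurable_snd)).const_mul
      Qmax).neg).exp
  · exact (measurable_initDist H hμ i).comp measurable_snd
  · refine measurable_intervalIntegral_param
      (f := fun (p : ℝ × (Fin n → ℝ)) s =>
        Real.exp (-(Qmax * (p.1 - s))) * shiftedE2rhs D Qmax v μ p.2 i s)
      (Measurable.mul ?_ ((measurable_shiftedE2rhs H hμ hv i).comp
        ((measurable_snd.comp measurable_fst).prodMk measurable_snd)))
      (measurable_startTime.comp measurable_snd) measurable_fst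
    exact ((((measurable_fst.comp measurable_fst).sub measurable_snd).const_mul Qmax).neg).exp

end Picard

section PicardStep

variable {S n : ℕ} {T : ℝ} {D : Model S n}
  {Lpsi LQ LPsi Llam Psimax psimax Qmax lammax : ℝ} {Jmax : ℕ}
  {K₁ K₂ P ε C : ℝ} {μ v μ₁ μ₂ v₁ v₂ : ℝ → (Fin n → ℝ) → Fin S → ℝ} {u : Fin n → ℝ} {t s : ℝ}

lemma Feasible.abs_E1rhs_le
    (H : Hyps S n T D Lpsi LQ LPsi Llam Psimax psimax Qmax lammax Jmax)
    (hF : Feasible S n T (valueBound n T Psimax psimax Qmax lammax) μ v)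
    (ht : memTS n T t u) (i : Fin S) :
    |E1rhs D μ v u i t| ≤ (Qmax + lammax) * valueBound n T Psimax psimax Qmax lammax (Zu u) t +
      (psimax + lammax * geomBound (Qmax + lammax) (Psimax + psimax * T) lammax T (n - Zu u)) := by
  obtain ⟨hPsi, hpsi, hQ, hlam⟩ := H.bounds_nonneg
  have hT := H.hT.le
  have h := MFGShocks.abs_E1rhs_le H ht (hF.mem_simplex t u ht) (hF.bound t u ht)
    (y := geomBound (Qmax + lammax) (Psimax + psimax * T) lammax T (n - Zu u)) (fun hZ i => by
      obtain ⟨h₁, h₂⟩ := ht.push hZ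
      refine (hF.bound _ _ h₁ i).trans ?_
      rw [h₂]
      refine (bwdWeight_le_geomBound_sub (by positivity) hPsi hpsi hlam ht.2.1.1
        ht.2.1.2 hZ).trans_eq ?_
      congr 1; omega)
    (geomBound_nonneg (by positivity) hlam hT _) i
  linarith

lemma Admissible.intervalIntegrable_E1rhs
    (H : Hyps S n T D Lpsi LQ LPsi Llam Psimax psimax Qmax lammax Jmax)
    (hA : Admissible S n T (valueBound n T Psimax psimax Qmax lammax) μ v)
    (ht : memTS n T t u) (i : Fin S) :
    IntervalIntegrable (E1rhs D μ v u i) volume t T := by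
  have hc : IntervalIntegrable (fun s => (Qmax + lammax) *
      valueBound n T Psimax psimax Qmax lammax (Zu u) s + (psimax + lammax *
        geomBound (Qmax + lammax) (Psimax + psimax * T) lammax T (n - Zu u))) volume t T := by
    have : Continuous (valueBound n T Psimax psimax Qmax lammax (Zu u)) :=
      continuous_bwdWeight _ _ _ _ _ _ _
    exact Continuous.intervalIntegrable (by fun_prop) _ _
  refine hc.mono_fun' ((measurable_E1rhs H hA.measurable_fst hA.measurable_snd i).comp
    measurable_prodMk_left).aestronglyMeasurable ?_
  rw [Set.uIoc_of_le ht.2.1.2]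
  exact (ae_restrict_iff' measurableSet_Ioc).2 (Filter.Eventually.of_forall fun s hs =>
    hA.abs_E1rhs_le H (ht.of_le hs.1.le hs.2) i)

lemma Admissible.intervalIntegrable_shiftedE2rhs
    (H : Hyps S n T D Lpsi LQ LPsi Llam Psimax psimax Qmax lammax Jmax)
    (hA : Admissible S n T (valueBound n T Psimax psimax Qmax lammax) μ v)
    (ht : memTS n T t u) (i : Fin S) :
    IntervalIntegrable (shiftedE2rhs D Qmax v μ u i) volume (startTime u) t := by
  have hu := memTS_startTime H.hT.le ht.1
  refine intervalIntegrable_of_bounded (C := Qmax)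
    ((measurable_shiftedE2rhs H hA.measurable_fst hA.measurable_snd i).comp
      measurable_prodMk_left) ((memTS_iff H.hT.le ht.1).1 ht).1 fun s hs => ?_
  have hs' := hu.of_le hs.1 (hs.2.trans ht.2.1.2)
  exact abs_shiftedE2rhs_le H hs' (hA.mem_simplex s u hs') i

lemma Admissible.intervalIntegrable_exp_mul
    (H : Hyps S n T D Lpsi LQ LPsi Llam Psimax psimax Qmax lammax Jmax)
    (hA : Admissible S n T (valueBound n T Psimax psimax Qmax lammax) μ v)
    (ht : memTS n T t u) (i : Fin S) :
    IntervalIntegrable (fun s => Real.exp (-(Qmax * (t - s))) * shiftedE2rhs D Qmax v μ u i s)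
      volume (startTime u) t :=
  (hA.intervalIntegrable_shiftedE2rhs H ht i).continuousOn_mul
    (Continuous.continuousOn (by fun_prop))

lemma initDist_mem_simplex
    (H : Hyps S n T D Lpsi LQ LPsi Llam Psimax psimax Qmax lammax Jmax)
    (hμ : ∀ t u, memTS n T t u → μ t u ∈ simplex S) (hu : memU n T u) :
    initDist D μ u ∈ simplex S := by
  unfold initDist
  split_ifs with hZ
  · exact H.hm0
  · exact relocate_mem_simplex _ (hμ _ _ (hu.pop H.hT.le (Nat.one_le_iff_ne_zero.2 hZ)).1)

lemma exp_add_integral_exp (q s t : ℝ) :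
    Real.exp (-(q * (t - s))) + ∫ r in s..t, Real.exp (-(q * (t - r))) * q = 1 := by
  have hd : ∀ r ∈ Set.uIcc s t, HasDerivAt (fun r => Real.exp (-(q * (t - r))))
      (Real.exp (-(q * (t - r))) * q) r := by
    intro r _
    have := ((((hasDerivAt_id r).const_sub t).const_mul q).neg).exp
    refine HasDerivAt.congr_deriv (f := fun r => Real.exp (-(q * (t - r)))) this ?_
    simp
  rw [intervalIntegral.integral_eq_sub_of_hasDerivAt hd
    (Continuous.intervalIntegrable (by fun_prop) _ _)]
  simp

lemma Admissible.picardFlow_mem_simplex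
    (H : Hyps S n T D Lpsi LQ LPsi Llam Psimax psimax Qmax lammax Jmax)
    (hA : Admissible S n T (valueBound n T Psimax psimax Qmax lammax) μ v)
    (ht : memTS n T t u) : picardFlow Qmax D μ v t u ∈ simplex S := by
  have hi := initDist_mem_simplex H hA.mem_simplex ht.1
  have hst := ((memTS_iff H.hT.le ht.1).1 ht).1
  have hmem : ∀ s ∈ Set.Icc (startTime u) t, memTS n T s u := fun s hs =>
    (memTS_startTime H.hT.le ht.1).of_le hs.1 (hs.2.trans ht.2.1.2)
  refine ⟨fun i => add_nonneg (mul_nonneg (Real.exp_nonneg _) (hi.1 i))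
    (intervalIntegral.integral_nonneg hst fun s hs => mul_nonneg (Real.exp_nonneg _)
      (shiftedE2rhs_nonneg H (hmem s hs) (hA.mem_simplex s u (hmem s hs)) i)), ?_⟩
  simp only [picardFlow, Finset.sum_add_distrib, ← Finset.mul_sum, hi.2, mul_one]
  rw [← intervalIntegral.integral_finsetSum fun i _ => hA.intervalIntegrable_exp_mul H ht i,
    ← exp_add_integral_exp Qmax (startTime u) t]
  congr 1
  refine intervalIntegral.integral_congr fun s hs => ?_
  rw [Set.uIcc_of_le hst] at hs
  simp only [← Finset.mul_sum, sum_shiftedE2rhs H (hA.mem_simplex s u (hmem s hs))]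

lemma Admissible.picard (H : Hyps S n T D Lpsi LQ LPsi Llam Psimax psimax Qmax lammax Jmax)
    (hA : Admissible S n T (valueBound n T Psimax psimax Qmax lammax) μ v) :
    Admissible S n T (valueBound n T Psimax psimax Qmax lammax)
      (picardFlow Qmax D μ v) (picardValue T D μ v) where
  mem_simplex t u ht := hA.picardFlow_mem_simplex H ht
  bound t u ht i := by
    obtain ⟨hPsi, hpsi, hQ, hlam⟩ := H.bounds_nonneg
    have hc : Continuous (valueBound n T Psimax psimax Qmax lammax (Zu u)) :=
      continuous_bwdWeight _ _ _ _ _ _ _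
    have h₁ := abs_integral_le_of_le ht.2.1.2 (hA.intervalIntegrable_E1rhs H ht i)
      (Continuous.intervalIntegrable (by fun_prop) _ _)
      fun s hs => hA.abs_E1rhs_le H (ht.of_le hs.1 hs.2) i
    have hTS := memTS_end H.hT.le ht.1
    have h₂ := H.Psi_bdd _ ht.1.Zu_le _ (hA.mem_simplex T u hTS) i
    exact ((abs_add_le _ _).trans (add_le_add h₂ h₁)).trans
      (bwdWeight_backward (by positivity) hPsi hpsi hlam H.hT.le ht.2.1.2)
  measurable_fst := measurable_picardFlow H hA.measurable_fst hA.measurable_snd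
  measurable_snd := measurable_picardValue H hA.measurable_fst hA.measurable_snd

lemma close_picard
    (W : SmallWeights n T Lpsi LQ LPsi Llam Psimax psimax Qmax lammax K₁ K₂ P ε)
    (H : Hyps S n T D Lpsi LQ LPsi Llam Psimax psimax Qmax lammax Jmax) (hC : 0 ≤ C)
    (h₁ : Admissible S n T (valueBound n T Psimax psimax Qmax lammax) μ₁ v₁)
    (h₂ : Admissible S n T (valueBound n T Psimax psimax Qmax lammax) μ₂ v₂)
    (h : Close T (fwdWeight Qmax LQ ε) (bwdWeight K₂ (ε + LPsi * P) (K₁ * P) lammax T n)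
      C μ₁ v₁ μ₂ v₂) :
    Close T (fwdWeight Qmax LQ ε) (bwdWeight K₂ (ε + LPsi * P) (K₁ * P) lammax T n)
      ((1 - ε / (P + 1)) * C) (picardFlow Qmax D μ₁ v₁) (picardValue T D μ₁ v₁)
      (picardFlow Qmax D μ₂ v₂) (picardValue T D μ₂ v₂) := by
  refine close_of_steps W H hC fun t u ht => ⟨?_, fun i => ?_⟩
  · obtain ⟨-, -, hQ, -⟩ := H.bounds_nonneg
    have hs₀ := ht.1.startTime_mem H.hT.le
    have hst := ((memTS_iff H.hT.le ht.1).1 ht).1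
    have hexp : ∀ s ≤ t, Real.exp (-(Qmax * (t - s))) ≤ 1 := fun s hs => by
      rw [Real.exp_le_one_iff, neg_nonpos]
      exact mul_nonneg hQ (sub_nonneg.2 hs)
    refine forward_step H hC (Real.exp_nonneg _) (hexp _ hst) hs₀.1 hst
      (sum_abs_initDist_sub_le H W.pos hC h ht.1) (h₁.intervalIntegrable_exp_mul H ht)
      (h₂.intervalIntegrable_exp_mul H ht) fun s hs => ?_
    have hs' : memTS n T s u := (memTS_iff H.hT.le ht.1).2 ⟨hs.1, hs.2.trans ht.2.1.2⟩
    have hsh := sum_abs_shiftedE2rhs_sub_le H hs' (h₁.mem_simplex s u hs')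
      (h₂.mem_simplex s u hs') (h s u hs').1 (x := C) fun i => ((h s u hs').2 i).trans
        (mul_le_of_le_one_right hC (W.bwd_bounds H hs').2)
    simp only [← mul_sub, abs_mul, abs_of_nonneg (Real.exp_nonneg _), ← Finset.mul_sum]
    refine (mul_le_of_le_one_left (Finset.sum_nonneg fun _ _ => abs_nonneg _)
      (hexp s hs.2)).trans ?_
    linarith
  · exact backward_step W H h₁.toFeasible h₂.toFeasible hC h ht i
      (h₁.intervalIntegrable_E1rhs H ht i) (h₂.intervalIntegrable_E1rhs H ht i)

lemma admissible_const (H : Hyps S n T D Lpsi LQ LPsi Llam Psimax psimax Qmax lammax Jmax) :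
    Admissible S n T (valueBound n T Psimax psimax Qmax lammax)
      (fun _ _ => D.m0) (fun _ _ => 0) where
  mem_simplex _ _ _ := H.hm0
  bound t u ht i := by
    obtain ⟨hPsi, hpsi, hQ, hlam⟩ := H.bounds_nonneg
    simp only [Pi.zero_apply, abs_zero]
    exact hPsi.trans (le_bwdWeight (by positivity) hPsi hpsi hlam H.hT.le ht.2.1.2)
  measurable_fst := measurable_const
  measurable_snd := measurable_const

/-- The Picard iterates, started from the constant pair `(m₀, 0)`. -/
noncomputable def picardIter (T Qmax : ℝ) (D : Model S n) :
    ℕ → (ℝ → (Fin n → ℝ) → Fin S → ℝ) × (ℝ → (Fin n → ℝ) → Fin S → ℝ)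
  | 0 => (fun _ _ => D.m0, fun _ _ => 0)
  | m + 1 => (picardFlow Qmax D (picardIter T Qmax D m).1 (picardIter T Qmax D m).2,
      picardValue T D (picardIter T Qmax D m).1 (picardIter T Qmax D m).2)

lemma admissible_picardIter
    (H : Hyps S n T D Lpsi LQ LPsi Llam Psimax psimax Qmax lammax Jmax) (m : ℕ) :
    Admissible S n T (valueBound n T Psimax psimax Qmax lammax)
      (picardIter T Qmax D m).1 (picardIter T Qmax D m).2 := by
  induction m with
  | zero => exact admissible_const H
  | succ m ih => exact ih.picard H

/-- Geometric control of successive differences makes real sequences converge geometrically. -/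
lemma abs_sub_limsup_le {x : ℕ → ℝ} {r c : ℝ} (hr : r < 1)
    (h : ∀ m, |x m - x (m + 1)| ≤ c * r ^ m) :
    Filter.Tendsto x Filter.atTop (nhds (Filter.limsup x Filter.atTop)) ∧
      ∀ m, |x m - Filter.limsup x Filter.atTop| ≤ c * r ^ m / (1 - r) := by
  obtain ⟨a, ha⟩ := cauchySeq_tendsto_of_complete (cauchySeq_of_le_geometric (f := x) r c hr h)
  rw [ha.limsup_eq]
  exact ⟨ha, dist_le_of_le_geometric_of_tendsto r c hr h ha⟩

lemma exists_picard_fixedPoint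
    (W : SmallWeights n T Lpsi LQ LPsi Llam Psimax psimax Qmax lammax K₁ K₂ P ε)
    (H : Hyps S n T D Lpsi LQ LPsi Llam Psimax psimax Qmax lammax Jmax) :
    ∃ μ v : ℝ → (Fin n → ℝ) → Fin S → ℝ,
      Admissible S n T (valueBound n T Psimax psimax Qmax lammax) μ v ∧
      ∀ t u, memTS n T t u →
        μ t u = picardFlow Qmax D μ v t u ∧ v t u = picardValue T D μ v t u := by
  have hA := admissible_picardIter H
  obtain ⟨θ₀, θ₁⟩ := W.contraction_mem H
  obtain ⟨-, -, hP⟩ := W.nonneg H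
  have hε := W.pos
  set θ := 1 - ε / (P + 1) with hθ
  set y : ℕ → ℝ → (Fin n → ℝ) → Fin S → ℝ := fun m => (picardIter T Qmax D m).1 with hy
  set w : ℕ → ℝ → (Fin n → ℝ) → Fin S → ℝ := fun m => (picardIter T Qmax D m).2 with hw
  obtain ⟨C, hC, hclose⟩ := exists_close_of_feasible W H (hA 0).toFeasible (hA 1).toFeasible
  have hm : ∀ m : ℕ, Close T (fwdWeight Qmax LQ ε)
      (bwdWeight K₂ (ε + LPsi * P) (K₁ * P) lammax T n) (θ ^ m * C)
      (y m) (w m) (y (m + 1)) (w (m + 1)) := by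
    intro m
    induction m with
    | zero => simpa using hclose
    | succ m ih =>
      have := close_picard W H (by positivity) (hA m) (hA (m + 1)) ih
      rwa [← mul_assoc, ← pow_succ'] at this
  have hyw : ∀ t u, memTS n T t u → ∀ i, ∀ m,
      |y m t u i - y (m + 1) t u i| ≤ C * (P + 1) * θ ^ m ∧
      |w m t u i - w (m + 1) t u i| ≤ C * (P + 1) * θ ^ m := by
    intro t u ht i m
    have := (hm m).abs_sub_le W H (by positivity) ht i
    rwa [show θ ^ m * C * (P + 1) = C * (P + 1) * θ ^ m by ring] at this
  set μ : ℝ → (Fin n → ℝ) → Fin S → ℝ :=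
    fun t u i => Filter.limsup (fun m => y m t u i) Filter.atTop with hμ
  set v : ℝ → (Fin n → ℝ) → Fin S → ℝ :=
    fun t u i => Filter.limsup (fun m => w m t u i) Filter.atTop with hv
  have hμl : ∀ t u, memTS n T t u → ∀ i,
      Filter.Tendsto (fun m => y m t u i) Filter.atTop (nhds (μ t u i)) ∧
      ∀ m, |y m t u i - μ t u i| ≤ C * (P + 1) * θ ^ m / (1 - θ) := fun t u ht i =>
    abs_sub_limsup_le θ₁ fun m => (hyw t u ht i m).1
  have hvl : ∀ t u, memTS n T t u → ∀ i,
      Filter.Tendsto (fun m => w m t u i) Filter.atTop (nhds (v t u i)) ∧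
      ∀ m, |w m t u i - v t u i| ≤ C * (P + 1) * θ ^ m / (1 - θ) := fun t u ht i =>
    abs_sub_limsup_le θ₁ fun m => (hyw t u ht i m).2
  have hadm : Admissible S n T (valueBound n T Psimax psimax Qmax lammax) μ v := by
    refine ⟨⟨fun t u ht => ⟨fun i => ?_, ?_⟩, fun t u ht i => ?_⟩, ?_, ?_⟩
    · exact ge_of_tendsto' (hμl t u ht i).1 fun m => ((hA m).mem_simplex t u ht).1 i
    · refine tendsto_nhds_unique (tendsto_finsetSum Finset.univ fun i _ => (hμl t u ht i).1) ?_
      simp only [fun m => ((hA m).mem_simplex t u ht).2, hy]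
      exact tendsto_const_nhds
    · exact le_of_tendsto' (hvl t u ht i).1.abs fun m => (hA m).bound t u ht i
    · exact measurable_pi_lambda _ fun i => Measurable.limsup fun m =>
        (measurable_pi_apply i).comp (hA m).measurable_fst
    · exact measurable_pi_lambda _ fun i => Measurable.limsup fun m =>
        (measurable_pi_apply i).comp (hA m).measurable_snd
  refine ⟨μ, v, hadm, fun t u ht => ?_⟩
  have hstep : ∀ m, Close T (fwdWeight Qmax LQ ε)
      (bwdWeight K₂ (ε + LPsi * P) (K₁ * P) lammax T n)
      (θ * (S * (C * (P + 1) * θ ^ m / (1 - θ)) / ε)) (y (m + 1)) (w (m + 1))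
      (picardFlow Qmax D μ v) (picardValue T D μ v) := by
    intro m
    have h1 : 0 < 1 - θ := sub_pos.2 θ₁
    exact close_picard W H (by positivity) (hA m) hadm (close_of_abs_sub_le W H
      fun t u ht i => ⟨(hμl t u ht i).2 m, (hvl t u ht i).2 m⟩)
  have hlim : Filter.Tendsto
      (fun m : ℕ => θ * (S * (C * (P + 1) * θ ^ m / (1 - θ)) / ε) * (P + 1)) Filter.atTop
      (nhds 0) := by
    simpa using (((((((tendsto_pow_atTop_nhds_zero_of_lt_one θ₀ θ₁).const_mul
      (C * (P + 1))).div_const (1 - θ)).const_mul (S : ℝ)).div_const ε).const_mul θ).mul_const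
        (P + 1))
  have habs : ∀ i m, |y (m + 1) t u i - picardFlow Qmax D μ v t u i| ≤
        θ * (S * (C * (P + 1) * θ ^ m / (1 - θ)) / ε) * (P + 1) ∧
      |w (m + 1) t u i - picardValue T D μ v t u i| ≤
        θ * (S * (C * (P + 1) * θ ^ m / (1 - θ)) / ε) * (P + 1) := fun i m => by
    have h1 : 0 < 1 - θ := sub_pos.2 θ₁
    exact (hstep m).abs_sub_le W H (by positivity) ht i
  constructor <;> ext i
  · exact tendsto_nhds_unique ((hμl t u ht i).1.comp (Filter.tendsto_add_atTop_nat 1))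
      (tendsto_iff_dist_tendsto_zero.2
        (squeeze_zero (fun _ => dist_nonneg) (fun m => (habs i m).1) hlim))
  · exact tendsto_nhds_unique ((hvl t u ht i).1.comp (Filter.tendsto_add_atTop_nat 1))
      (tendsto_iff_dist_tendsto_zero.2
        (squeeze_zero (fun _ => dist_nonneg) (fun m => (habs i m).2) hlim))

end PicardStep

section FixedPoint

variable {S n : ℕ} {T : ℝ} {D : Model S n}
  {Lpsi LQ LPsi Llam Psimax psimax Qmax lammax : ℝ} {Jmax : ℕ}
  {μ v : ℝ → (Fin n → ℝ) → Fin S → ℝ}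

lemma Admissible.intervalIntegrable_E2rhs
    (H : Hyps S n T D Lpsi LQ LPsi Llam Psimax psimax Qmax lammax Jmax)
    (hA : Admissible S n T (valueBound n T Psimax psimax Qmax lammax) μ v) {u : Fin n → ℝ}
    {s t : ℝ} (hs : memTS n T s u) (hst : s ≤ t) (htT : t ≤ T) (i : Fin S) :
    IntervalIntegrable (E2rhs D v μ u i) volume s t := by
  have hm : Measurable (E2rhs D v μ u i) := by
    have h₁ : Measurable (shiftedE2rhs D Qmax v μ u i) :=
      (measurable_shiftedE2rhs H hA.measurable_fst hA.measurable_snd i).comp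
        measurable_prodMk_left
    have h₂ : Measurable fun s => μ s u i :=
      (measurable_pi_apply i).comp (hA.measurable_fst.comp measurable_prodMk_right)
    have e : E2rhs D v μ u i = fun s => shiftedE2rhs D Qmax v μ u i s - Qmax * μ s u i := by
      ext s; simp [shiftedE2rhs]
    rw [e]
    exact h₁.sub (h₂.const_mul _)
  refine intervalIntegrable_of_bounded (C := Qmax) hm hst fun r hr => ?_
  have hr' := hs.of_le hr.1 (hr.2.trans htT)
  exact abs_E2rhs_le H hr' (hA.mem_simplex r u hr') i

lemma Admissible.solBackward
    (H : Hyps S n T D Lpsi LQ LPsi Llam Psimax psimax Qmax lammax Jmax)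
    (hA : Admissible S n T (valueBound n T Psimax psimax Qmax lammax) μ v)
    (hv : ∀ t u, memTS n T t u → v t u = picardValue T D μ v t u) :
    SolBackward S n T D μ v := by
  intro u hu
  refine ⟨fun i => ?_, fun t ht i => ⟨hA.intervalIntegrable_E1rhs H ht i, ?_⟩⟩
  · rw [hv T u (memTS_end H.hT.le hu)]
    simp [picardValue]
  · exact congrFun (hv t u ht) i

lemma Admissible.solForward
    (H : Hyps S n T D Lpsi LQ LPsi Llam Psimax psimax Qmax lammax Jmax)
    (hA : Admissible S n T (valueBound n T Psimax psimax Qmax lammax) μ v)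
    (hμ : ∀ t u, memTS n T t u → μ t u = picardFlow Qmax D μ v t u) :
    SolForward S n T D v μ := by
  have hstart : ∀ u, memU n T u → μ (startTime u) u = initDist D μ u := by
    intro u hu
    rw [hμ _ u (memTS_startTime H.hT.le hu)]
    ext i
    simp [picardFlow]
  refine ⟨fun i => ?_, fun u hu hZ j => ?_, fun u hu t ht i => ?_⟩
  · have := hstart _ (memU_neg_one (n := n) (T := T))
    rw [initDist, startTime, if_pos Zu_neg_one, if_pos Zu_neg_one] at this
    exact congrFun this i
  · have := hstart u hu
    rw [initDist, if_neg (by omega), startTime_of_pos hZ] at this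
    exact congrFun this j
  · have hst := ((memTS_iff H.hT.le hu).1 ht).1
    have hs₀ := memTS_startTime H.hT.le hu
    refine ⟨hA.intervalIntegrable_E2rhs H hs₀ hst ht.2.1.2 i, ?_⟩
    rw [hstart u hu]
    have := eq_add_integral_of_variation_of_constants (q := Qmax) (x₀ := initDist D μ u i)
      (x := fun s => μ s u i) hst (hA.intervalIntegrable_shiftedE2rhs H ht i) fun s hs =>
        congrFun (hμ s u (hs₀.of_le hs.1 (hs.2.trans ht.2.1.2))) i
    simpa [shiftedE2rhs] using this

lemma Admissible.regular_fst
    (H : Hyps S n T D Lpsi LQ LPsi Llam Psimax psimax Qmax lammax Jmax)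
    (hA : Admissible S n T (valueBound n T Psimax psimax Qmax lammax) μ v)
    (hF : SolForward S n T D v μ) : Regular S n T μ := by
  obtain ⟨-, -, hQ, -⟩ := H.bounds_nonneg
  intro u hu
  have hs₀ := memTS_startTime H.hT.le hu
  refine absContOn_of_lipschitz hQ fun s t hs hst ht => ?_
  have hs' := hs₀.of_le hs (hst.trans ht)
  refine (pi_norm_le_iff_of_nonneg (mul_nonneg hQ (sub_nonneg.2 hst))).2 fun i => ?_
  obtain ⟨i₁, e₁⟩ := hF.2.2 u hu s hs' i
  obtain ⟨-, e₂⟩ := hF.2.2 u hu t (hs'.of_le hst ht) i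
  have hi := hA.intervalIntegrable_E2rhs H hs' hst ht i
  rw [Pi.sub_apply, e₁, e₂, add_sub_add_left_eq_sub,
    ← intervalIntegral.integral_add_adjacent_intervals i₁ hi, add_sub_cancel_left]
  refine (abs_integral_le_of_le hst hi intervalIntegrable_const fun r hr => abs_E2rhs_le H
    (hs'.of_le hr.1 (hr.2.trans ht)) (hA.mem_simplex _ _ (hs'.of_le hr.1 (hr.2.trans ht)))
      i).trans_eq ?_
  simp [mul_comm]

lemma Admissible.regular_snd
    (H : Hyps S n T D Lpsi LQ LPsi Llam Psimax psimax Qmax lammax Jmax)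
    (hA : Admissible S n T (valueBound n T Psimax psimax Qmax lammax) μ v)
    (hB : SolBackward S n T D μ v) : Regular S n T v := by
  obtain ⟨-, hpsi, hQ, hlam⟩ := H.bounds_nonneg
  have hV := H.vmaxC_nonneg
  intro u hu
  have hs₀ := memTS_startTime H.hT.le hu
  set V := vmaxC n T Psimax psimax Qmax lammax
  have hK : 0 ≤ psimax + (Qmax + lammax) * V + lammax * V := by positivity
  refine absContOn_of_lipschitz hK fun s t hs hst ht => ?_
  have hs' := hs₀.of_le hs (hst.trans ht)
  refine (pi_norm_le_iff_of_nonneg (mul_nonneg hK (sub_nonneg.2 hst))).2 fun i => ?_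
  obtain ⟨i₁, e₁⟩ := (hB u hu).2 s hs' i
  obtain ⟨i₂, e₂⟩ := (hB u hu).2 t (hs'.of_le hst ht) i
  have hi : IntervalIntegrable (E1rhs D μ v u i) volume s t := i₁.trans i₂.symm
  rw [Pi.sub_apply, e₁, e₂, add_sub_add_left_eq_sub,
    ← intervalIntegral.integral_add_adjacent_intervals hi i₂, sub_add_cancel_right, norm_neg]
  refine (abs_integral_le_of_le hst hi intervalIntegrable_const fun r hr => ?_).trans_eq
    (by simp only [intervalIntegral.integral_const, smul_eq_mul]; exact mul_comm _ _)
  have hr' := hs'.of_le hr.1 (hr.2.trans ht)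
  exact abs_E1rhs_le H hr' (hA.mem_simplex r u hr')
    (fun i => (hA.bound r u hr' i).trans (H.valueBound_le hr'))
    (fun hZ i => (hA.bound r _ (hr'.push hZ).1 i).trans (H.valueBound_le (hr'.push hZ).1)) hV i

/-- The smallness condition on the horizon leaves room for strictly positive `ε`. -/
lemma exists_smallWeights
    (H : Hyps S n T D Lpsi LQ LPsi Llam Psimax psimax Qmax lammax Jmax)
    (hsmall :
      LQ * T * (∑ i ∈ Finset.range (n + 1),
          (Real.exp ((Qmax + LQ) * T)) ^ (i + 1) * (Jmax : ℝ) ^ i) *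
        ((LPsi + K1C n T Lpsi LQ Llam Psimax psimax Qmax lammax * T) *
          Real.exp (K2C n T Lpsi LQ Psimax psimax Qmax lammax * T) *
          ∑ i ∈ Finset.range (n + 1),
            (Real.exp (K2C n T Lpsi LQ Psimax psimax Qmax lammax * T) * lammax * T) ^ i)
        < 1) :
    ∃ K₁ K₂ P ε, SmallWeights n T Lpsi LQ LPsi Llam Psimax psimax Qmax lammax K₁ K₂ P ε := by
  obtain ⟨-, -, hQ, hlam⟩ := H.bounds_nonneg
  have hV := H.vmaxC_nonneg
  have hLQ := H.hLQ
  have hLPsi := H.hLPsi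
  have hLpsi := H.hLpsi
  have hLlam := H.hLlam
  have hT := H.hT
  set K₁ := K1C n T Lpsi LQ Llam Psimax psimax Qmax lammax with hK₁
  set K₂ := K2C n T Lpsi LQ Psimax psimax Qmax lammax with hK₂
  have hK₁₀ : 0 ≤ K₁ := by rw [hK₁, K1C]; positivity
  set A := (LPsi + K₁ * T) * Real.exp (K₂ * T) *
    ∑ i ∈ Finset.range (n + 1), (Real.exp (K₂ * T) * lammax * T) ^ i with hA
  have hA₀ : 0 ≤ A := mul_nonneg (by positivity) (Finset.sum_nonneg fun i _ => by positivity)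
  have hsum : Real.exp ((Qmax + LQ) * T) ≤ ∑ i ∈ Finset.range (n + 1),
      (Real.exp ((Qmax + LQ) * T)) ^ (i + 1) * (Jmax : ℝ) ^ i := by
    refine le_trans ?_ (Finset.single_le_sum (fun i _ => by positivity)
      (Finset.mem_range.2 (Nat.succ_pos n)))
    simp
  have h₀ : geomBound K₂ (0 + LPsi * fwdWeight Qmax LQ 0 n T + K₁ * fwdWeight Qmax LQ 0 n T * T)
      lammax T (n + 1) < 1 := by
    refine lt_of_le_of_lt (le_of_eq_of_le ?_ (mul_le_mul_of_nonneg_right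
      (mul_le_mul_of_nonneg_left hsum (by positivity : 0 ≤ LQ * T)) hA₀)) hsmall
    rw [hA, geomBound, fwdWeight, expWeight]
    ring
  have hcont : Continuous fun ε : ℝ => geomBound K₂ (ε + LPsi * fwdWeight Qmax LQ ε n T +
      K₁ * fwdWeight Qmax LQ ε n T * T) lammax T (n + 1) := by
    unfold geomBound fwdWeight expWeight
    fun_prop
  have hev := (hcont.tendsto 0).eventually (gt_mem_nhds h₀)
  obtain ⟨ε, hε, hpos⟩ := ((hev.filter_mono nhdsWithin_le_nhds).and
    (self_mem_nhdsWithin (s := Set.Ioi (0 : ℝ)))).exists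
  exact ⟨K₁, K₂, fwdWeight Qmax LQ ε n T, ε, hK₁, hK₂, rfl, hpos, hε.le⟩

end FixedPoint

/-- **Theorem 3.4 / Theorem B.1** (existence and uniqueness for the equilibrium system on a
short time horizon). Under the Lipschitz assumptions, if the time horizon `T` satisfies the
smallness condition
`L_Q̂ T (Σ_{i=0}^{n} (e^{(Qmax+L_Q̂)T})^{i+1} Jmax^i) (L_Ψ + K₁T) e^{K₂T}
  (Σ_{i=0}^{n} (e^{K₂T} λmax T)^i) < 1`,
then there is a unique pair `(μ, v)` of regular functions, with `μ` valued in the probability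
simplex on `TS`, solving the equilibrium system (E1)–(E5). -/
theorem equilibrium_exists_unique (S n : ℕ) (T : ℝ) (D : Model S n)
    (Lpsi LQ LPsi Llam Psimax psimax Qmax lammax : ℝ) (Jmax : ℕ)
    (H : Hyps S n T D Lpsi LQ LPsi Llam Psimax psimax Qmax lammax Jmax)
    (hsmall :
      LQ * T * (∑ i ∈ Finset.range (n + 1),
          (Real.exp ((Qmax + LQ) * T)) ^ (i + 1) * (Jmax : ℝ) ^ i) *
        ((LPsi + K1C n T Lpsi LQ Llam Psimax psimax Qmax lammax * T) *
          Real.exp (K2C n T Lpsi LQ Psimax psimax Qmax lammax * T) *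
          ∑ i ∈ Finset.range (n + 1),
            (Real.exp (K2C n T Lpsi LQ Psimax psimax Qmax lammax * T) * lammax * T) ^ i)
        < 1) :
    ∃ μ v : ℝ → (Fin n → ℝ) → Fin S → ℝ,
      (Regular S n T μ ∧ ∀ t u, memTS n T t u → μ t u ∈ simplex S) ∧
      Regular S n T v ∧
      SolBackward S n T D μ v ∧ SolForward S n T D v μ ∧
      ∀ μ' v' : ℝ → (Fin n → ℝ) → Fin S → ℝ,
        Regular S n T μ' → (∀ t u, memTS n T t u → μ' t u ∈ simplex S) →
        Regular S n T v' →
        SolBackward S n T D μ' v' → SolForward S n T D v' μ' →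
        ∀ t u, memTS n T t u → μ' t u = μ t u ∧ v' t u = v t u := by
  obtain ⟨K₁, K₂, P, ε, W⟩ := exists_smallWeights H hsmall
  obtain ⟨μ, v, hA, hfix⟩ := exists_picard_fixedPoint W H
  have hB := hA.solBackward H fun t u ht => (hfix t u ht).2
  have hF := hA.solForward H fun t u ht => (hfix t u ht).1
  exact ⟨μ, v, ⟨hA.regular_fst H hF, hA.mem_simplex⟩, hA.regular_snd H hB, hB, hF,
    fun μ' v' _ hμ' _ hB' hF' t u ht => eq_of_solutions W H hμ' hA.mem_simplex hB' hF' hB hF ht⟩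

end MFGShocks
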